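/- arXiv:2107.07017 — 4 statements merged into one kernel-verified Lean document; each statement's English description precedes it below -/
import Mathlib

section
/- (Theorem A) For every A > 1 there exists a constant C > 0, depending only on A, such that for every real Hilbert space H, every rectifiable Jordan arc Γ ⊆ H, and every multiresolution family Ĝ for Γ with inflation factor A, one has Σ_{Q ∈ Ĝ} β(Q)² diam(Q) ≤ C·(ℓ(Γ) − crd(Γ)). -/
open Metric MeasureTheory
open scoped ENNReal

/-- The affine line through `p` with direction `v`. -/
def lineThrough {H : Type*} [NormedAddCommGroup H] [InnerProductSpace ℝ H]
    (p v : H) : Set H :=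
  {y | ∃ t : ℝ, y = p + t • v}

/-- The Jones beta number of a set `Q` relative to the arc `Γ`. -/
noncomputable def jonesBeta {H : Type*} [NormedAddCommGroup H] [InnerProductSpace ℝ H]
    (Γ Q : Set H) : ℝ :=
  (2 / Metric.diam Q) *
    sInf {r : ℝ | ∃ p v : H, v ≠ 0 ∧
      r = sSup ((fun x => Metric.infDist x (lineThrough p v)) '' (Q ∩ Γ))}

/-- `γ` is an arclength parameterization of a rectifiable Jordan arc of length `L`:
injective and 1-Lipschitz on `[0, L]`, with the length of `γ` restricted to any
subinterval `[s, t]` equal to `t - s`. -/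
structure IsArclengthParam {H : Type*} [NormedAddCommGroup H] [InnerProductSpace ℝ H]
    (γ : ℝ → H) (L : ℝ) : Prop where
  len_nonneg : 0 ≤ L
  inj : Set.InjOn γ (Set.Icc 0 L)
  lip : LipschitzOnWith 1 γ (Set.Icc 0 L)
  arclen : ∀ s t : ℝ, 0 ≤ s → s ≤ t → t ≤ L →
    eVariationOn γ (Set.Icc s t) = ENNReal.ofReal (t - s)

/-- `X` determines a multiresolution family for `Γ` with starting scale `n₀`:
a nested sequence of `2⁻ⁿ`-nets for `Γ`. -/
structure IsMultiresolution {H : Type*} [NormedAddCommGroup H] [InnerProductSpace ℝ H]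
    (Γ : Set H) (n₀ : ℤ) (X : ℤ → Set H) : Prop where
  subset_arc : ∀ n, n₀ ≤ n → X n ⊆ Γ
  nested : ∀ n, n₀ ≤ n → X n ⊆ X (n + 1)
  separated : ∀ n, n₀ ≤ n → ∀ x ∈ X n, ∀ y ∈ X n, x ≠ y → (2:ℝ)^(-n) < dist x y
  covers : ∀ n, n₀ ≤ n → Γ ⊆ ⋃ x ∈ X n, Metric.ball x ((2:ℝ)^(-n))

/-- The beta sum `Σ_{Q ∈ Ĝ} β(Q)² diam(Q)` of a multiresolution family with
inflation factor `A`, valued in `[0, ∞]`. -/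
noncomputable def betaSum {H : Type*} [NormedAddCommGroup H] [InnerProductSpace ℝ H]
    (Γ : Set H) (A : ℝ) (n₀ : ℤ) (X : ℤ → Set H) : ℝ≥0∞ :=
  ∑' (n : {m : ℤ // n₀ ≤ m}), ∑' (x : X n.1),
    ENNReal.ofReal
      (jonesBeta Γ (Metric.ball (x : H) (A * (2:ℝ)^(-n.1))) ^ 2 * (2 * A * (2:ℝ)^(-n.1)))

/-- The infimal total diameter of countable covers of `Γ` by sets of diameter at most `δ`. -/
noncomputable def coverLength {H : Type*} [PseudoMetricSpace H] (Γ : Set H) (δ : ℝ) : ℝ≥0∞ :=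
  ⨅ (t : ℕ → Set H) (_ : Γ ⊆ ⋃ n, t n) (_ : ∀ n, ediam (t n) ≤ ENNReal.ofReal δ),
    ∑' n, ediam (t n)

section CoverLength

variable {H : Type*} [PseudoMetricSpace H]

lemma coverLength_le_tsum {Γ : Set H} {δ : ℝ} {ι : Type*} [Countable ι] (t : ι → Set H)
    (hΓ : Γ ⊆ ⋃ i, t i) (hδ : ∀ i, ediam (t i) ≤ ENNReal.ofReal δ) :
    coverLength Γ δ ≤ ∑' i, ediam (t i) := by
  have := Encodable.ofCountable ι
  rw [← tsum_iUnion_decode₂ (fun s : Set H => ediam s) (by simp) t]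
  refine iInf₂_le_of_le _ ?_ (iInf_le _ ?_)
  · rw [Encodable.iUnion_decode₂]
    exact hΓ
  · intro n
    refine Encodable.iUnion_decode₂_cases (C := fun s : Set H => ediam s ≤ ENNReal.ofReal δ) ?_ hδ
    simp

lemma coverLength_antitone (Γ : Set H) : Antitone (coverLength Γ) := by
  intro δ δ' h
  refine le_iInf₂ fun t ht => le_iInf fun hδ => ?_
  exact coverLength_le_tsum t ht fun n => (hδ n).trans (ENNReal.ofReal_le_ofReal h)

/-- If the images under a `1`-Lipschitz function of the pieces indexed by `N` cover `[p, q]`,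
their total diameter is at least `q - p`. -/
lemma ofReal_sub_le_tsum_ediam {t : ℕ → Set H} {N : Set ℕ} {f : H → ℝ} (hf : LipschitzWith 1 f)
    {p q : ℝ} (h : ∀ x ∈ Set.Icc p q, ∃ n ∈ N, x ∈ f '' t n) :
    ENNReal.ofReal (q - p) ≤ ∑' n, N.indicator (fun n => ediam (t n)) n := by
  rw [← Real.volume_Icc, ← tsum_subtype N (fun n => ediam (t n))]
  have h1 : Set.Icc p q ⊆ ⋃ n ∈ N, f '' t n := by
    intro x hx
    obtain ⟨n, hn, hx⟩ := h x hx
    exact Set.mem_biUnion hn hx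
  refine (measure_mono h1).trans ((measure_biUnion_le _ (Set.to_countable N) _).trans ?_)
  refine ENNReal.tsum_le_tsum fun n => (Real.volume_le_diam _).trans ?_
  simpa using hf.ediam_image_le (t n)

/-- The pieces of a cover of a curve which meet the part of the curve where a `1`-Lipschitz
function takes values in `[p, q]` have total diameter at least `q - p`. -/
lemma ofReal_sub_le_tsum_of_curve {γ : ℝ → H} {L : ℝ} (hγ : ContinuousOn γ (Set.Icc 0 L))
    {t : ℕ → Set H} (ht : γ '' Set.Icc 0 L ⊆ ⋃ n, t n) {f : H → ℝ} (hf : LipschitzWith 1 f)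
    {s₁ s₂ : ℝ} (h₁ : s₁ ∈ Set.Icc 0 L) (h₂ : s₂ ∈ Set.Icc 0 L) {p q : ℝ}
    (hp : f (γ s₁) ≤ p) (hq : q ≤ f (γ s₂)) {N : Set ℕ}
    (hN : ∀ n, ∀ s ∈ Set.uIcc s₁ s₂, γ s ∈ t n → f (γ s) ∈ Set.Icc p q → n ∈ N) :
    ENNReal.ofReal (q - p) ≤ ∑' n, N.indicator (fun n => ediam (t n)) n := by
  refine ofReal_sub_le_tsum_ediam hf fun x hx => ?_
  have hsub : Set.uIcc s₁ s₂ ⊆ Set.Icc 0 L := Set.uIcc_subset_Icc h₁ h₂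
  have hc : ContinuousOn (f ∘ γ) (Set.uIcc s₁ s₂) := hf.continuous.comp_continuousOn (hγ.mono hsub)
  have hx' : x ∈ Set.uIcc ((f ∘ γ) s₁) ((f ∘ γ) s₂) :=
    Set.mem_uIcc_of_le (hp.trans hx.1) (hx.2.trans hq)
  obtain ⟨s, hs, rfl⟩ := intermediate_value_uIcc hc hx'
  obtain ⟨n, hn⟩ := Set.mem_iUnion.1 (ht ⟨s, hsub hs, rfl⟩)
  exact ⟨n, hN n s hs hn hx, γ s, hn, rfl⟩

lemma ofReal_dist_le_coverLength {γ : ℝ → H} {L : ℝ} (hL : 0 ≤ L)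
    (hγ : ContinuousOn γ (Set.Icc 0 L)) (δ : ℝ) :
    ENNReal.ofReal (dist (γ L) (γ 0)) ≤ coverLength (γ '' Set.Icc 0 L) δ := by
  refine le_iInf₂ fun t ht => le_iInf fun hδ => ?_
  have := ofReal_sub_le_tsum_of_curve hγ ht (f := fun z => dist z (γ 0))
    (LipschitzWith.dist_left _) (s₁ := 0) (s₂ := L) (p := 0) (q := dist (γ L) (γ 0)) (N := Set.univ)
    ⟨le_rfl, hL⟩ ⟨hL, le_rfl⟩ (by simp) le_rfl (fun _ _ _ _ _ => trivial)
  simpa using this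

lemma coverLength_le_ofReal {γ : ℝ → H} {L : ℝ} (hL : 0 ≤ L)
    (hγ : LipschitzOnWith 1 γ (Set.Icc 0 L)) {δ : ℝ} (hδ : 0 < δ) :
    coverLength (γ '' Set.Icc 0 L) δ ≤ ENNReal.ofReal L := by
  obtain ⟨n, hn⟩ := exists_nat_gt (L / δ)
  have hn0 : (0 : ℝ) < n := (by positivity : 0 ≤ L / δ).trans_lt hn
  have hnδ : L / n ≤ δ := by
    rw [div_le_iff₀ hn0]
    rw [div_lt_iff₀ hδ] at hn
    linarith
  have hd : ∀ i : Fin n, ediam (γ '' (Set.Icc 0 L ∩ Set.Icc (i * (L / n)) ((i + 1) * (L / n))))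
      ≤ ENNReal.ofReal (L / n) := by
    intro i
    refine ediam_le ?_
    rintro _ ⟨u, hu, rfl⟩ _ ⟨v, hv, rfl⟩
    rw [edist_dist]
    refine ENNReal.ofReal_le_ofReal ((hγ.dist_le_mul u hu.1 v hv.1).trans ?_)
    refine (le_of_eq (by simp)).trans ((Real.dist_le_of_mem_Icc hu.2 hv.2).trans ?_)
    linarith
  refine (coverLength_le_tsum
    (fun i : Fin n => γ '' (Set.Icc 0 L ∩ Set.Icc (i * (L / n)) ((i + 1) * (L / n)))) ?_
    fun i => (hd i).trans (ENNReal.ofReal_le_ofReal hnδ)).trans ?_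
  · rintro _ ⟨s, hs, rfl⟩
    rcases hL.eq_or_lt with rfl | hLpos
    · have hs0 : s = 0 := le_antisymm hs.2 hs.1
      refine Set.mem_iUnion.2 ⟨⟨0, by exact_mod_cast hn0⟩, s, ⟨hs, ?_⟩, rfl⟩
      simp [hs0]
    · have hq : 0 < L / n := by positivity
      rcases hs.2.eq_or_lt with rfl | hsL
      · refine Set.mem_iUnion.2 ⟨⟨n - 1, Nat.sub_lt (by exact_mod_cast hn0) one_pos⟩, s,
          ⟨hs, ?_⟩, rfl⟩
        have h1 : ((n - 1 : ℕ) : ℝ) = n - 1 := by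
          rw [Nat.cast_sub (by exact_mod_cast hn0)]; simp
        have h2 : (n : ℝ) * (s / n) = s := by field_simp
        simp only [h1]
        constructor <;> nlinarith
      · have h0 : 0 ≤ s / (L / n) := div_nonneg hs.1 hq.le
        have h1 := Nat.floor_le h0
        have h2 := Nat.lt_floor_add_one (s / (L / n))
        rw [le_div_iff₀ hq] at h1
        rw [div_lt_iff₀ hq] at h2
        have h3 : ⌊s / (L / n)⌋₊ < n := by
          rw [Nat.floor_lt h0, div_lt_iff₀ hq]
          have : (n : ℝ) * (L / n) = L := by field_simp
          linarith
        exact Set.mem_iUnion.2 ⟨⟨_, h3⟩, s, ⟨hs, h1, h2.le⟩, rfl⟩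
  · refine (ENNReal.tsum_le_tsum hd).trans ?_
    rw [tsum_fintype]
    simp only [Finset.sum_const, Finset.card_univ, Fintype.card_fin, nsmul_eq_mul]
    rw [← ENNReal.ofReal_natCast, ← ENNReal.ofReal_mul hn0.le]
    exact ENNReal.ofReal_le_ofReal (by field_simp; exact le_rfl)

/-- Merging all pieces of a fine cover which meet one of finitely many separated sets `S y`. -/
lemma coverLength_add_le {Γ : Set H} {δ δ' : ℝ} (hδ' : 0 ≤ δ') (hδδ' : δ' ≤ δ) {ι : Type*}
    (Y : Finset ι) (S : ι → Set H) (Δ : ι → ℝ) (g : ι → ℝ≥0∞)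
    (hsep : ∀ y ∈ Y, ∀ y' ∈ Y, y ≠ y' → ∀ u ∈ S y, ∀ v ∈ S y', δ' < dist u v)
    (hdiam : ∀ y ∈ Y, ∀ u ∈ S y, ∀ v ∈ S y, dist u v + 2 * δ' ≤ Δ y)
    (hΔ : ∀ y ∈ Y, Δ y ≤ δ)
    (hlow : ∀ y ∈ Y, ∀ t : ℕ → Set H, Γ ⊆ ⋃ n, t n → (∀ n, ediam (t n) ≤ ENNReal.ofReal δ') →
      ENNReal.ofReal (Δ y) + g y ≤
        ∑' n, {n | (t n ∩ S y).Nonempty}.indicator (fun n => ediam (t n)) n) :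
    coverLength Γ δ + ∑ y ∈ Y, g y ≤ coverLength Γ δ' := by
  classical
  refine le_iInf₂ fun t ht => le_iInf fun hδt => ?_
  have hdist : ∀ n, ∀ u ∈ t n, ∀ v ∈ t n, dist u v ≤ δ' := by
    intro n u hu v hv
    have := (edist_le_ediam_of_mem hu hv).trans (hδt n)
    rwa [edist_dist, ENNReal.ofReal_le_ofReal_iff hδ'] at this
  set N : ι → Set ℕ := fun y => {n | (t n ∩ S y).Nonempty} with hN
  have hdisj : ∀ y ∈ Y, ∀ y' ∈ Y, ∀ n, n ∈ N y → n ∈ N y' → y = y' := by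
    rintro y hy y' hy' n ⟨u, hu, hu'⟩ ⟨v, hv, hv'⟩
    by_contra hne
    exact absurd (hdist n u hu v hv) (not_le.2 (hsep y hy y' hy' hne u hu' v hv'))
  set M : Set ℕ := {n | ∀ y ∈ Y, n ∉ N y} with hM
  let T : ℕ ⊕ Y → Set H := Sum.elim (fun n => if n ∈ M then t n else ∅)
    (fun y => ⋃ n ∈ N y, t n)
  have hT2 : ∀ y : Y, ediam (⋃ n ∈ N y, t n) ≤ ENNReal.ofReal (Δ y) := by
    intro y
    refine ediam_le fun a ha b hb => ?_
    obtain ⟨n, hn, ha⟩ := Set.mem_iUnion₂.1 ha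
    obtain ⟨m, hm, hb⟩ := Set.mem_iUnion₂.1 hb
    obtain ⟨u, hu, hu'⟩ := hn
    obtain ⟨v, hv, hv'⟩ := hm
    rw [edist_dist]
    refine ENNReal.ofReal_le_ofReal ?_
    have h1 := hdist n a ha u hu
    have h2 := hdist m v hv b hb
    have h3 := hdiam y y.2 u hu' v hv'
    have h4 := dist_triangle4 a u v b
    linarith
  have hcov : coverLength Γ δ ≤ ∑' i, ediam (T i) := by
    refine coverLength_le_tsum T ?_ ?_
    · intro x hx
      obtain ⟨n, hn⟩ := Set.mem_iUnion.1 (ht hx)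
      by_cases hnM : n ∈ M
      · exact Set.mem_iUnion.2 ⟨Sum.inl n, by simpa [T, hnM] using hn⟩
      · simp only [hM, Set.mem_ofPred_eq, not_forall, not_not] at hnM
        obtain ⟨y, hy, hny⟩ := hnM
        exact Set.mem_iUnion.2 ⟨Sum.inr ⟨y, hy⟩, Set.mem_biUnion hny hn⟩
    · rintro (n | y)
      · by_cases hnM : n ∈ M
        · simpa [T, hnM] using (hδt n).trans (ENNReal.ofReal_le_ofReal hδδ')
        · simp [T, hnM]
      · exact (hT2 y).trans (ENNReal.ofReal_le_ofReal (hΔ y y.2))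
  have hsum : ∑' i, ediam (T i) ≤
      ∑' n, M.indicator (fun n => ediam (t n)) n + ∑ y ∈ Y, ENNReal.ofReal (Δ y) := by
    rw [ENNReal.summable.tsum_sum ENNReal.summable]
    refine add_le_add (le_of_eq ?_) ?_
    · refine tsum_congr fun n => ?_
      by_cases hnM : n ∈ M <;> simp [T, hnM]
    · rw [tsum_fintype, ← Finset.sum_coe_sort Y]
      exact Finset.sum_le_sum fun y _ => hT2 y
  calc coverLength Γ δ + ∑ y ∈ Y, g y
      ≤ (∑' n, M.indicator (fun n => ediam (t n)) n + ∑ y ∈ Y, ENNReal.ofReal (Δ y))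
        + ∑ y ∈ Y, g y := by gcongr; exact hcov.trans hsum
    _ = ∑' n, M.indicator (fun n => ediam (t n)) n + ∑ y ∈ Y, (ENNReal.ofReal (Δ y) + g y) := by
        rw [Finset.sum_add_distrib, add_assoc]
    _ ≤ ∑' n, M.indicator (fun n => ediam (t n)) n
        + ∑ y ∈ Y, ∑' n, (N y).indicator (fun n => ediam (t n)) n := by
        gcongr with y hy
        exact hlow y hy t ht hδt
    _ = ∑' n, (M.indicator (fun n => ediam (t n)) n
        + ∑ y ∈ Y, (N y).indicator (fun n => ediam (t n)) n) := by
        rw [ENNReal.tsum_add, Summable.tsum_finsetSum fun _ _ => ENNReal.summable]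
    _ ≤ ∑' n, ediam (t n) := by
        refine ENNReal.tsum_le_tsum fun n => ?_
        by_cases hnM : n ∈ M
        · have : ∑ y ∈ Y, (N y).indicator (fun n => ediam (t n)) n = 0 :=
            Finset.sum_eq_zero fun y hy => Set.indicator_of_notMem (hnM y hy) _
          simp [this, hnM]
        · rw [Set.indicator_of_notMem hnM, zero_add]
          simp only [hM, Set.mem_ofPred_eq, not_forall, not_not] at hnM
          obtain ⟨y, hy, hny⟩ := hnM
          rw [Finset.sum_eq_single y]
          · exact Set.indicator_le_self _ _ n
          · intro y' hy' hne
            exact Set.indicator_of_notMem (fun h => hne (hdisj y' hy' y hy n h hny)) _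
          · exact fun h => absurd hy h

end CoverLength

section Partition

/-- `u ≤ v` are consecutive points of `C`. -/
def IsGap (C : Set ℝ) (u v : ℝ) : Prop :=
  u ∈ C ∧ v ∈ C ∧ u ≤ v ∧ ∀ x ∈ C, x ≤ u ∨ v ≤ x

lemma exists_isGap_around {C : Set ℝ} (hC : IsClosed C) {L : ℝ} (h0 : (0 : ℝ) ∈ C) (hL : L ∈ C)
    {s : ℝ} (hs : s ∈ Set.Icc 0 L) :
    ∃ u v, u ∈ C ∧ v ∈ C ∧ u ≤ s ∧ s ≤ v ∧ (∀ x ∈ C, x ≤ s → x ≤ u) ∧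
      (∀ x ∈ C, s ≤ x → v ≤ x) := by
  have hu := (hC.inter isClosed_Iic).csSup_mem (s := C ∩ Set.Iic s) ⟨0, h0, hs.1⟩
    ⟨s, fun x hx => hx.2⟩
  have hv := (hC.inter isClosed_Ici).csInf_mem (s := C ∩ Set.Ici s) ⟨L, hL, hs.2⟩
    ⟨s, fun x hx => hx.2⟩
  exact ⟨_, _, hu.1, hv.1, hu.2, hv.2, fun x hx hxs => le_csSup ⟨s, fun x hx => hx.2⟩ ⟨hx, hxs⟩,
    fun x hx hxs => csInf_le ⟨s, fun x hx => hx.2⟩ ⟨hx, hxs⟩⟩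

lemma isGap_of_around {C : Set ℝ} {s u v : ℝ} (hu : u ∈ C) (hv : v ∈ C) (hus : u ≤ s) (hsv : s ≤ v)
    (h₁ : ∀ x ∈ C, x ≤ s → x ≤ u) (h₂ : ∀ x ∈ C, s ≤ x → v ≤ x) : IsGap C u v :=
  ⟨hu, hv, hus.trans hsv, fun x hx => (le_total x s).imp (h₁ x hx) (h₂ x hx)⟩

/-- A point with small excess with respect to `p, q` is close to the segment `[p, q]`. -/
lemma exists_mem_segment_dist_sq_le {H : Type*} [NormedAddCommGroup H] [InnerProductSpace ℝ H]
    (p q x : H) :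
    ∃ w ∈ segment ℝ p q,
      dist x w ^ 2 ≤ 2 * dist p x * (dist p x + dist x q - dist p q) := by
  rcases eq_or_ne (dist p x + dist x q) 0 with h | h
  · have h1 : dist p x = 0 := by
      linarith [dist_nonneg (x := p) (y := x), dist_nonneg (x := x) (y := q)]
    exact ⟨p, left_mem_segment ℝ p q, by rw [dist_comm x p, h1]; simp⟩
  · have hα : 0 ≤ dist p x := dist_nonneg
    have hβ : 0 ≤ dist x q := dist_nonneg
    have hc : 0 ≤ dist p q := dist_nonneg
    have htri := dist_triangle p x q
    have hS : 0 < dist p x + dist x q := lt_of_le_of_ne (by positivity) (Ne.symm h)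
    generalize hα' : dist p x = α at *
    generalize hβ' : dist x q = β at *
    generalize hc' : dist p q = c at *
    have hsum : β / (α + β) + α / (α + β) = 1 := by field_simp; ring
    refine ⟨(β / (α + β)) • p + (α / (α + β)) • q,
      ⟨_, _, by positivity, by positivity, hsum, rfl⟩, ?_⟩
    have key : dist x ((β / (α + β)) • p + (α / (α + β)) • q) ^ 2
        = (β / (α + β)) * α ^ 2 + (α / (α + β)) * β ^ 2
          - (β / (α + β)) * (α / (α + β)) * c ^ 2 := by
      have e1 : x - ((β / (α + β)) • p + (α / (α + β)) • q)
          = (β / (α + β)) • (x - p) + (α / (α + β)) • (x - q) := by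
        have : x = (β / (α + β) + α / (α + β)) • x := by rw [hsum, one_smul]
        nth_rewrite 1 [this]
        module
      have e2 : p - q = (x - q) - (x - p) := by abel
      rw [← hα', ← hβ', ← hc'] at *
      rw [dist_comm p x, dist_eq_norm x p, dist_eq_norm x q, dist_eq_norm p q] at *
      rw [dist_eq_norm, e1, e2, norm_add_sq_real, norm_sub_sq_real (x - q), norm_smul, norm_smul,
        inner_smul_left, inner_smul_right, real_inner_comm (x - q)]
      simp only [Real.norm_eq_abs, mul_pow, sq_abs, conj_trivial]
      have hs2 : ‖x - q‖ / (‖x - p‖ + ‖x - q‖) = 1 - ‖x - p‖ / (‖x - p‖ + ‖x - q‖) := by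
        linarith
      rw [hs2]
      ring
    rw [key]
    have e3 : (β / (α + β)) * α ^ 2 + (α / (α + β)) * β ^ 2
          - (β / (α + β)) * (α / (α + β)) * c ^ 2
        = α * (β / (α + β)) * ((α + β - c) * ((α + β + c) / (α + β))) := by
      field_simp
      ring
    rw [e3]
    have h1 : β / (α + β) ≤ 1 := by rw [div_le_one hS]; linarith
    have h2 : (α + β + c) / (α + β) ≤ 2 := by rw [div_le_iff₀ hS]; linarith
    have h0 : 0 ≤ α + β - c := by linarith
    calc α * (β / (α + β)) * ((α + β - c) * ((α + β + c) / (α + β)))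
        ≤ α * 1 * ((α + β - c) * 2) := by gcongr
      _ = 2 * α * (α + β - c) := by ring

/-- Finitely many disjoint parameter arcs at each of `N` geometric scales `R k`, such that the arcs
of scale `k` have diameter at most `R k` and are more than `R k` apart. -/
structure ArcSystem {H ι : Type*} [NormedAddCommGroup H] (γ : ℝ → H) (L : ℝ) (N : ℕ) (R : ℕ → ℝ)
    (Y : ℕ → Finset ι) (a b : ℕ → ι → ℝ) : Prop where
  len_nonneg : 0 ≤ L
  R_pos : ∀ k, 0 < R k
  R_succ : ∀ k, R (k + 1) = R k / 8
  left_nonneg : ∀ k < N, ∀ y ∈ Y k, 0 ≤ a k y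
  left_le : ∀ k < N, ∀ y ∈ Y k, a k y ≤ b k y
  right_le : ∀ k < N, ∀ y ∈ Y k, b k y ≤ L
  dist_le : ∀ k < N, ∀ y ∈ Y k, ∀ s ∈ Set.Icc (a k y) (b k y), ∀ s' ∈ Set.Icc (a k y) (b k y),
    dist (γ s) (γ s') ≤ R k
  lt_dist : ∀ k < N, ∀ y ∈ Y k, ∀ y' ∈ Y k, y ≠ y' → ∀ s ∈ Set.Icc (a k y) (b k y),
    ∀ s' ∈ Set.Icc (a k y') (b k y'), R k < dist (γ s) (γ s')

/-- The parameters which lie in no arc of scale at least `k`. -/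
def breakpoints {ι : Type*} (L : ℝ) (N : ℕ) (Y : ℕ → Finset ι) (a b : ℕ → ι → ℝ) (k : ℕ) : Set ℝ :=
  {s | s ∈ Set.Icc 0 L ∧ ∀ j, k ≤ j → j < N → ∀ y ∈ Y j, s ∉ Set.Ioo (a j y) (b j y)}

/-- The length of the polygon through the breakpoints of scale `k` between `u` and `v`. -/
noncomputable def polygonLength {H ι : Type*} [NormedAddCommGroup H] (γ : ℝ → H) (L : ℝ) (N : ℕ)
    (Y : ℕ → Finset ι) (a b : ℕ → ι → ℝ) (k : ℕ) (u v : ℝ) : ℝ :=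
  (eVariationOn γ (breakpoints L N Y a b k ∩ Set.Icc u v)).toReal

/-- The geometrically weighted increments of the polygon lengths at scales finer than `k`. -/
noncomputable def weightedIncrement {H ι : Type*} [NormedAddCommGroup H] (γ : ℝ → H) (L : ℝ) (N : ℕ)
    (Y : ℕ → Finset ι) (a b : ℕ → ι → ℝ) (k : ℕ) (u v : ℝ) : ℝ :=
  ∑ j ∈ Finset.Ico k N, (1 / 2 : ℝ) ^ (j - k) *
    (polygonLength γ L N Y a b (j + 1) u v - polygonLength γ L N Y a b j u v)

namespace ArcSystem

variable {H ι : Type*} [NormedAddCommGroup H] {γ : ℝ → H} {L : ℝ} {N : ℕ} {R : ℕ → ℝ}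
  {Y : ℕ → Finset ι} {a b : ℕ → ι → ℝ}

lemma breakpoints_mono : Monotone (breakpoints L N Y a b) :=
  fun _ _ h _ hs => ⟨hs.1, fun j hj => hs.2 j (h.trans hj)⟩

lemma isClosed_breakpoints (k : ℕ) : IsClosed (breakpoints L N Y a b k) := by
  have : breakpoints L N Y a b k = Set.Icc 0 L ∩
      ⋂ j, ⋂ (_ : k ≤ j), ⋂ (_ : j < N), ⋂ y ∈ Y j, (Set.Ioo (a j y) (b j y))ᶜ := by
    ext s
    simp only [breakpoints, Set.mem_inter_iff, Set.mem_iInter, Set.mem_compl_iff,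
      Set.mem_ofPred_eq]
  rw [this]
  exact isClosed_Icc.inter (isClosed_iInter fun j => isClosed_iInter fun _ => isClosed_iInter
    fun _ => isClosed_iInter fun y => isClosed_iInter fun _ => isOpen_Ioo.isClosed_compl)

lemma breakpoints_last : breakpoints L N Y a b N = Set.Icc 0 L := by
  ext s
  exact ⟨fun h => h.1, fun h => ⟨h, fun j h1 h2 => absurd h1 (not_le.2 h2)⟩⟩

lemma zero_mem (h : ArcSystem γ L N R Y a b) (k : ℕ) : (0 : ℝ) ∈ breakpoints L N Y a b k :=
  ⟨⟨le_rfl, h.len_nonneg⟩, fun j _ hj y hy hs => absurd hs.1 (not_lt.2 (h.left_nonneg j hj y hy))⟩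

lemma len_mem (h : ArcSystem γ L N R Y a b) (k : ℕ) : L ∈ breakpoints L N Y a b k :=
  ⟨⟨h.len_nonneg, le_rfl⟩, fun j _ hj y hy hs => absurd hs.2 (not_lt.2 (h.right_le j hj y hy))⟩

lemma exists_mem_Ioo {k : ℕ} {s : ℝ} (hs : s ∈ breakpoints L N Y a b (k + 1))
    (hs' : s ∉ breakpoints L N Y a b k) : k < N ∧ ∃ y ∈ Y k, s ∈ Set.Ioo (a k y) (b k y) := by
  by_contra hcon
  refine hs' ⟨hs.1, fun j hkj hj y hy hmem => ?_⟩
  rcases hkj.eq_or_lt with rfl | hlt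
  · exact hcon ⟨hj, y, hy, hmem⟩
  · exact hs.2 j hlt hj y hy hmem

lemma dist_le_left (h : ArcSystem γ L N R Y a b) {k : ℕ} (hk : k < N)
    (ih : ∀ u v, IsGap (breakpoints L N Y a b (k + 1)) u v → ∀ s ∈ Set.Icc u v,
      ∀ s' ∈ Set.Icc u v, dist (γ s) (γ s') ≤ 4 / 3 * R (k + 1))
    {y : ι} (hy : y ∈ Y k) {u : ℝ} (hu : u ∈ breakpoints L N Y a b k) (hua : u ≤ a k y)
    (hmax : ∀ x ∈ breakpoints L N Y a b k, x ≤ a k y → x ≤ u) :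
    ∀ s ∈ Set.Icc u (a k y), ∀ s' ∈ Set.Icc u (a k y), dist (γ s) (γ s') ≤ R k / 6 := by
  have ha : a k y ∈ Set.Icc 0 L :=
    ⟨h.left_nonneg k hk y hy, (h.left_le k hk y hy).trans (h.right_le k hk y hy)⟩
  obtain ⟨c, e, hc, he, hca, hae, h1, h2⟩ := exists_isGap_around
    (isClosed_breakpoints (k + 1)) (h.zero_mem (k + 1)) (h.len_mem (k + 1)) ha
  have hgap := ih c e (isGap_of_around hc he hca hae h1 h2)
  have hR : 4 / 3 * R (k + 1) = R k / 6 := by rw [h.R_succ]; ring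
  rw [hR] at hgap
  have huc : u ≤ c := h1 u (breakpoints_mono k.le_succ hu) hua
  have hcu : c ≤ u := by
    by_contra hlt
    have hck : c ∉ breakpoints L N Y a b k := fun hck => hlt (hmax c hck hca)
    obtain ⟨-, y', hy', hcy'⟩ := exists_mem_Ioo hc hck
    have hne : y ≠ y' := by
      rintro rfl
      exact absurd hca (not_le.2 hcy'.1)
    have h3 := h.lt_dist k hk y hy y' hy' hne (a k y) ⟨le_rfl, h.left_le k hk y hy⟩ c
      ⟨hcy'.1.le, hcy'.2.le⟩
    have h4 := hgap (a k y) ⟨hca, hae⟩ c ⟨le_rfl, hca.trans hae⟩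
    linarith [h.R_pos k]
  intro s hs s' hs'
  exact hgap s ⟨hcu.trans hs.1, hs.2.trans hae⟩ s' ⟨hcu.trans hs'.1, hs'.2.trans hae⟩

lemma dist_le_right (h : ArcSystem γ L N R Y a b) {k : ℕ} (hk : k < N)
    (ih : ∀ u v, IsGap (breakpoints L N Y a b (k + 1)) u v → ∀ s ∈ Set.Icc u v,
      ∀ s' ∈ Set.Icc u v, dist (γ s) (γ s') ≤ 4 / 3 * R (k + 1))
    {y : ι} (hy : y ∈ Y k) {v : ℝ} (hv : v ∈ breakpoints L N Y a b k) (hbv : b k y ≤ v)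
    (hmin : ∀ x ∈ breakpoints L N Y a b k, b k y ≤ x → v ≤ x) :
    ∀ s ∈ Set.Icc (b k y) v, ∀ s' ∈ Set.Icc (b k y) v, dist (γ s) (γ s') ≤ R k / 6 := by
  have hb : b k y ∈ Set.Icc 0 L :=
    ⟨(h.left_nonneg k hk y hy).trans (h.left_le k hk y hy), h.right_le k hk y hy⟩
  obtain ⟨c, e, hc, he, hca, hae, h1, h2⟩ := exists_isGap_around
    (isClosed_breakpoints (k + 1)) (h.zero_mem (k + 1)) (h.len_mem (k + 1)) hb
  have hgap := ih c e (isGap_of_around hc he hca hae h1 h2)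
  have hR : 4 / 3 * R (k + 1) = R k / 6 := by rw [h.R_succ]; ring
  rw [hR] at hgap
  have hev : e ≤ v := h2 v (breakpoints_mono k.le_succ hv) hbv
  have hve : v ≤ e := by
    by_contra hlt
    have hek : e ∉ breakpoints L N Y a b k := fun hek => hlt (hmin e hek hae)
    obtain ⟨-, y', hy', hey'⟩ := exists_mem_Ioo he hek
    have hne : y ≠ y' := by
      rintro rfl
      exact absurd hae (not_le.2 hey'.2)
    have h3 := h.lt_dist k hk y hy y' hy' hne (b k y) ⟨h.left_le k hk y hy, le_rfl⟩ e
      ⟨hey'.1.le, hey'.2.le⟩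
    have h4 := hgap (b k y) ⟨hca, hae⟩ e ⟨hca.trans hae, le_rfl⟩
    linarith [h.R_pos k]
  intro s hs s' hs'
  exact hgap s ⟨hca.trans hs.1, hs.2.trans hve⟩ s' ⟨hca.trans hs'.1, hs'.2.trans hve⟩

/-- The curve has diameter comparable to `R k` between consecutive breakpoints of scale `k`. -/
lemma dist_le_of_isGap (h : ArcSystem γ L N R Y a b) {k : ℕ} (hk : k ≤ N) :
    ∀ u v, IsGap (breakpoints L N Y a b k) u v → ∀ s ∈ Set.Icc u v,
      ∀ s' ∈ Set.Icc u v, dist (γ s) (γ s') ≤ 4 / 3 * R k := by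
  induction hk using Nat.decreasingInduction with
  | self =>
    intro u v hg s hs s' hs'
    rw [breakpoints_last] at hg
    obtain ⟨hu, hv, huv, hx⟩ := hg
    have : u = v := by
      rcases hx ((u + v) / 2) ⟨by linarith [hu.1, hv.1], by linarith [hu.2, hv.2]⟩ with h1 | h1 <;>
        linarith
    subst this
    rw [Set.Icc_self, Set.mem_singleton_iff] at hs hs'
    rw [hs, hs', dist_self]
    linarith [h.R_pos N]
  | of_succ k hk ih =>
    rintro u v ⟨hu, hv, huv, hx⟩
    by_cases hex : ∃ c ∈ breakpoints L N Y a b (k + 1), u < c ∧ c < v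
    · obtain ⟨c, hc, huc, hcv⟩ := hex
      have hck : c ∉ breakpoints L N Y a b k := fun hck => by
        rcases hx c hck with h1 | h1 <;> linarith
      obtain ⟨-, y, hy, hcy⟩ := exists_mem_Ioo hc hck
      have hua : u ≤ a k y := by
        by_contra hlt
        exact hu.2 k le_rfl hk y hy ⟨not_le.1 hlt, huc.trans hcy.2⟩
      have hbv : b k y ≤ v := by
        by_contra hlt
        exact hv.2 k le_rfl hk y hy ⟨hcy.1.trans hcv, not_le.1 hlt⟩
      have hl := h.dist_le_left hk ih hy hu hua fun x hxk hxa =>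
        (hx x hxk).resolve_right fun h1 => by linarith [hcy.1]
      have hr := h.dist_le_right hk ih hy hv hbv fun x hxk hxa =>
        (hx x hxk).resolve_left fun h1 => by linarith [hcy.2]
      have hab := h.left_le k hk y hy
      have hm := h.dist_le k hk y hy
      have hRk := h.R_pos k
      have main : ∀ s ∈ Set.Icc u v, ∀ s' ∈ Set.Icc u v, s ≤ s' →
          dist (γ s) (γ s') ≤ 4 / 3 * R k := by
        intro s hs s' hs' hss'
        have t1 := dist_triangle (γ s) (γ (a k y)) (γ s')
        have t2 := dist_triangle (γ s) (γ (b k y)) (γ s')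
        have t3 := dist_triangle4 (γ s) (γ (a k y)) (γ (b k y)) (γ s')
        have q := hm (a k y) ⟨le_rfl, hab⟩ (b k y) ⟨hab, le_rfl⟩
        rcases le_total s (a k y) with h1 | h1
        · have q1 := hl s ⟨hs.1, h1⟩ (a k y) ⟨hua, le_rfl⟩
          rcases le_total s' (a k y) with h2 | h2
          · linarith [hl s ⟨hs.1, h1⟩ s' ⟨hs'.1, h2⟩]
          · rcases le_total s' (b k y) with h3 | h3
            · linarith [hm (a k y) ⟨le_rfl, hab⟩ s' ⟨h2, h3⟩]
            · linarith [hr (b k y) ⟨le_rfl, hbv⟩ s' ⟨h3, hs'.2⟩]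
        · rcases le_total s' (b k y) with h3 | h3
          · linarith [hm s ⟨h1, hss'.trans h3⟩ s' ⟨h1.trans hss', h3⟩]
          · rcases le_total s (b k y) with h4 | h4
            · linarith [hm s ⟨h1, h4⟩ (b k y) ⟨hab, le_rfl⟩,
                hr (b k y) ⟨le_rfl, hbv⟩ s' ⟨h3, hs'.2⟩]
            · linarith [hr s ⟨h4, hs.2⟩ s' ⟨h3, hs'.2⟩]
      intro s hs s' hs'
      rcases le_total s s' with h1 | h1
      · exact main s hs s' hs' h1
      · rw [dist_comm]
        exact main s' hs' s hs h1
    · push Not at hex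
      intro s hs s' hs'
      refine (ih u v ⟨breakpoints_mono k.le_succ hu, breakpoints_mono k.le_succ hv, huv,
        fun x hx => ?_⟩ s hs s' hs').trans ?_
      · by_cases hux : u < x
        · exact Or.inr (hex x hx hux)
        · exact Or.inl (not_lt.1 hux)
      · rw [h.R_succ]
        linarith [h.R_pos k]

lemma eVariationOn_ne_top (hfin : eVariationOn γ (Set.Icc 0 L) ≠ ⊤) (k : ℕ) (u v : ℝ) :
    eVariationOn γ (breakpoints L N Y a b k ∩ Set.Icc u v) ≠ ⊤ :=
  ne_top_of_le_ne_top hfin (eVariationOn.mono γ fun _ hs => hs.1.1)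

lemma polygonLength_add (hfin : eVariationOn γ (Set.Icc 0 L) ≠ ⊤) {k : ℕ} {u c v : ℝ} (huc : u ≤ c)
    (hcv : c ≤ v) (hc : c ∈ breakpoints L N Y a b k) :
    polygonLength γ L N Y a b k u c + polygonLength γ L N Y a b k c v =
      polygonLength γ L N Y a b k u v := by
  unfold polygonLength
  rw [← eVariationOn.Icc_add_Icc γ huc hcv hc, ENNReal.toReal_add (eVariationOn_ne_top hfin _ _ _)
    (eVariationOn_ne_top hfin _ _ _)]

lemma polygonLength_mono (hfin : eVariationOn γ (Set.Icc 0 L) ≠ ⊤) {j k : ℕ} (hjk : j ≤ k)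
    (u v : ℝ) : polygonLength γ L N Y a b j u v ≤ polygonLength γ L N Y a b k u v :=
  ENNReal.toReal_mono (eVariationOn_ne_top hfin _ _ _)
    (eVariationOn.mono γ (Set.inter_subset_inter_left _ (breakpoints_mono hjk)))

lemma dist_le_polygonLength (hfin : eVariationOn γ (Set.Icc 0 L) ≠ ⊤) {k : ℕ} {u v : ℝ}
    (hu : u ∈ breakpoints L N Y a b k) (hv : v ∈ breakpoints L N Y a b k) (huv : u ≤ v) :
    dist (γ u) (γ v) ≤ polygonLength γ L N Y a b k u v := by
  unfold polygonLength
  rw [dist_edist]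
  exact ENNReal.toReal_mono (eVariationOn_ne_top hfin _ _ _)
    (eVariationOn.edist_le γ ⟨hu, le_rfl, huv⟩ ⟨hv, huv, le_rfl⟩)

lemma polygonLength_of_isGap {k : ℕ} {u v : ℝ} (hg : IsGap (breakpoints L N Y a b k) u v) :
    polygonLength γ L N Y a b k u v = dist (γ u) (γ v) := by
  have : breakpoints L N Y a b k ∩ Set.Icc u v = {u, v} := by
    ext x
    constructor
    · rintro ⟨hx, hx1, hx2⟩
      rcases hg.2.2.2 x hx with h1 | h1
      · exact Or.inl (le_antisymm h1 hx1)
      · exact Or.inr (le_antisymm hx2 h1)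
    · rintro (rfl | rfl)
      · exact ⟨hg.1, le_rfl, hg.2.2.1⟩
      · exact ⟨hg.2.1, hg.2.2.1, le_rfl⟩
  rw [polygonLength, this, eVariationOn.pair, dist_edist]

lemma weightedIncrement_nonneg (hfin : eVariationOn γ (Set.Icc 0 L) ≠ ⊤) (k : ℕ) (u v : ℝ) :
    0 ≤ weightedIncrement γ L N Y a b k u v :=
  Finset.sum_nonneg fun j _ => mul_nonneg (by positivity)
    (sub_nonneg.2 (polygonLength_mono hfin j.le_succ u v))

lemma weightedIncrement_add (hfin : eVariationOn γ (Set.Icc 0 L) ≠ ⊤) {k : ℕ} {u c v : ℝ}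
    (huc : u ≤ c) (hcv : c ≤ v) (hc : c ∈ breakpoints L N Y a b k) :
    weightedIncrement γ L N Y a b k u c + weightedIncrement γ L N Y a b k c v =
      weightedIncrement γ L N Y a b k u v := by
  unfold weightedIncrement
  rw [← Finset.sum_add_distrib]
  refine Finset.sum_congr rfl fun j hj => ?_
  have hkj := (Finset.mem_Ico.1 hj).1
  rw [← polygonLength_add hfin huc hcv (breakpoints_mono hkj hc),
    ← polygonLength_add hfin huc hcv (breakpoints_mono (hkj.trans j.le_succ) hc)]
  ring

lemma weightedIncrement_mono (hfin : eVariationOn γ (Set.Icc 0 L) ≠ ⊤) {k : ℕ} {u c e v : ℝ}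
    (huc : u ≤ c) (hce : c ≤ e) (hev : e ≤ v) (hc : c ∈ breakpoints L N Y a b k)
    (he : e ∈ breakpoints L N Y a b k) :
    weightedIncrement γ L N Y a b k c e ≤ weightedIncrement γ L N Y a b k u v := by
  rw [← weightedIncrement_add hfin huc (hce.trans hev) hc, ← weightedIncrement_add hfin hce hev he]
  linarith [weightedIncrement_nonneg (Y := Y) (a := a) (b := b) (N := N) hfin k u c,
    weightedIncrement_nonneg (Y := Y) (a := a) (b := b) (N := N) hfin k e v]

lemma weightedIncrement_succ {k : ℕ} (hk : k < N) (u v : ℝ) :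
    weightedIncrement γ L N Y a b k u v =
      polygonLength γ L N Y a b (k + 1) u v - polygonLength γ L N Y a b k u v +
        1 / 2 * weightedIncrement γ L N Y a b (k + 1) u v := by
  unfold weightedIncrement
  rw [Finset.sum_eq_sum_Ico_succ_bot hk, Finset.mul_sum]
  congr 1
  · simp
  · refine Finset.sum_congr rfl fun j hj => ?_
    have : j - k = j - (k + 1) + 1 := by
      have := (Finset.mem_Ico.1 hj).1
      omega
    rw [this, pow_succ]
    ring

lemma sum_weightedIncrement_le (hfin : eVariationOn γ (Set.Icc 0 L) ≠ ⊤) (u v : ℝ) :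
    ∑ k ∈ Finset.range N, weightedIncrement γ L N Y a b k u v ≤
      2 * (polygonLength γ L N Y a b N u v - polygonLength γ L N Y a b 0 u v) := by
  set W : ℕ → ℝ := fun k => weightedIncrement γ L N Y a b k u v with hW
  have h1 : ∑ k ∈ Finset.range N, W k =
      (polygonLength γ L N Y a b N u v - polygonLength γ L N Y a b 0 u v) +
        1 / 2 * ∑ k ∈ Finset.range N, W (k + 1) := by
    rw [← Finset.sum_range_sub (fun k => polygonLength γ L N Y a b k u v), Finset.mul_sum,
      ← Finset.sum_add_distrib]
    exact Finset.sum_congr rfl fun k hk => weightedIncrement_succ (Finset.mem_range.1 hk) u v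
  have h2 : ∑ k ∈ Finset.range N, W (k + 1) ≤ ∑ k ∈ Finset.range N, W k := by
    have h3 := Finset.sum_range_succ W N
    rw [Finset.sum_range_succ'] at h3
    have h4 : W N = 0 := by simp [hW, weightedIncrement]
    have h5 : 0 ≤ W 0 := weightedIncrement_nonneg hfin 0 u v
    linarith
  linarith

lemma sum_weightedIncrement_disjoint_le (hfin : eVariationOn γ (Set.Icc 0 L) ≠ ⊤) {κ : Type*}
    {k : ℕ} (S : Finset κ) (c e : κ → ℝ)
    (hc : ∀ i ∈ S, c i ∈ breakpoints L N Y a b k) (he : ∀ i ∈ S, e i ∈ breakpoints L N Y a b k)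
    (hce : ∀ i ∈ S, c i ≤ e i)
    (hdisj : ∀ i ∈ S, ∀ j ∈ S, i ≠ j → e i ≤ c j ∨ e j ≤ c i) :
    ∀ T ∈ breakpoints L N Y a b k, (∀ i ∈ S, e i ≤ T) →
    ∑ i ∈ S, weightedIncrement γ L N Y a b k (c i) (e i) ≤
      weightedIncrement γ L N Y a b k 0 T := by
  classical
  induction S using Finset.induction_on_max_value (fun i => c i + e i) with
  | empty => simpa using fun T _ => weightedIncrement_nonneg hfin k 0 T
  | insert i S hi hmax ih =>
    intro T hT hST
    have hii := Finset.mem_insert_self i S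
    have hS : ∀ j ∈ S, j ∈ insert i S := fun j hj => Finset.mem_insert_of_mem hj
    rw [Finset.sum_insert hi]
    have h1 := ih (fun j hj => hc j (hS j hj)) (fun j hj => he j (hS j hj))
      (fun j hj => hce j (hS j hj)) (fun j hj j' hj' => hdisj j (hS j hj) j' (hS j' hj'))
      (c i) (hc i hii) (fun j hj => by
        have h2 := hmax j hj
        have h3 := hce i hii
        have h4 := hce j (hS j hj)
        rcases hdisj i hii j (hS j hj) (fun hij => hi (hij ▸ hj)) with h5 | h5
        · linarith
        · exact h5)
    have hc0 : 0 ≤ c i := (hc i hii).1.1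
    rw [← weightedIncrement_add hfin hc0 ((hce i hii).trans (hST i hii)) (hc i hii),
      ← weightedIncrement_add hfin (hce i hii) (hST i hii) (he i hii)]
    linarith [weightedIncrement_nonneg (Y := Y) (a := a) (b := b) (N := N) hfin k (e i) T]

end ArcSystem

end Partition

section Tree

namespace ArcSystem

variable {H ι : Type*} [NormedAddCommGroup H] [InnerProductSpace ℝ H] {γ : ℝ → H} {L : ℝ} {N : ℕ}
  {R : ℕ → ℝ} {Y : ℕ → Finset ι} {a b : ℕ → ι → ℝ}

/-- Between consecutive breakpoints the curve stays close to the segment joining them. -/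
lemma exists_mem_segment_of_isGap (h : ArcSystem γ L N R Y a b)
    (hfin : eVariationOn γ (Set.Icc 0 L) ≠ ⊤) {k : ℕ} (hk : k ≤ N) :
    ∀ u v, IsGap (breakpoints L N Y a b k) u v → ∀ s ∈ Set.Icc u v,
      ∃ w ∈ segment ℝ (γ u) (γ v),
        dist (γ s) w ^ 2 ≤ 16 / 3 * R k * weightedIncrement γ L N Y a b k u v := by
  induction hk using Nat.decreasingInduction with
  | self =>
    intro u v hg s hs
    have h1 := h.dist_le_of_isGap (k := N) le_rfl
    rw [breakpoints_last] at hg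
    obtain ⟨hu, hv, huv, hx⟩ := hg
    have huv' : u = v := by
      rcases hx ((u + v) / 2) ⟨by linarith [hu.1, hv.1], by linarith [hu.2, hv.2]⟩ with h1 | h1 <;>
        linarith
    subst huv'
    rw [Set.Icc_self, Set.mem_singleton_iff] at hs
    exact ⟨γ u, left_mem_segment ℝ _ _, by simp [hs, weightedIncrement]⟩
  | of_succ k hk ih =>
    intro u v hg s hs
    have hdiam := h.dist_le_of_isGap (Nat.le_of_succ_le hk) u v hg
    have hlen := polygonLength_of_isGap (γ := γ) hg
    obtain ⟨hu, hv, huv, -⟩ := hg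
    have hu' := breakpoints_mono k.le_succ hu
    have hv' := breakpoints_mono k.le_succ hv
    have hs0 : s ∈ Set.Icc 0 L := ⟨hu.1.1.trans hs.1, hs.2.trans hv.1.2⟩
    obtain ⟨c, e, hc, he, hcs, hse, h1, h2⟩ := exists_isGap_around
      (isClosed_breakpoints (k + 1)) (h.zero_mem (k + 1)) (h.len_mem (k + 1)) hs0
    have huc : u ≤ c := h1 u hu' hs.1
    have hev : e ≤ v := h2 v hv' hs.2
    obtain ⟨w', hw', hsw'⟩ := ih c e (isGap_of_around hc he hcs hse h1 h2) s ⟨hcs, hse⟩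
    have hRk := h.R_pos k
    set d := polygonLength γ L N Y a b (k + 1) u v - polygonLength γ L N Y a b k u v with hd
    have hd0 : 0 ≤ d := sub_nonneg.2 (polygonLength_mono hfin k.le_succ u v)
    have hclose : ∀ x ∈ breakpoints L N Y a b (k + 1), u ≤ x → x ≤ v →
        ∃ w ∈ segment ℝ (γ u) (γ v), dist (γ x) w ≤ √(8 / 3 * R k * d) := by
      intro x hx hux hxv
      obtain ⟨w, hw, hxw⟩ := exists_mem_segment_dist_sq_le (γ u) (γ v) (γ x)
      refine ⟨w, hw, Real.le_sqrt_of_sq_le (hxw.trans ?_)⟩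
      have e1 := hdiam u ⟨le_rfl, huv⟩ x ⟨hux, hxv⟩
      have e2 := dist_le_polygonLength hfin hu' hx hux
      have e3 := dist_le_polygonLength hfin hx hv' hxv
      have e4 := polygonLength_add hfin hux hxv hx
      have e5 := dist_triangle (γ u) (γ x) (γ v)
      calc 2 * dist (γ u) (γ x) * (dist (γ u) (γ x) + dist (γ x) (γ v) - dist (γ u) (γ v))
          ≤ 2 * (4 / 3 * R k) * d := by gcongr; linarith
        _ = 8 / 3 * R k * d := by ring
    obtain ⟨w₁, hw₁, hcw⟩ := hclose c hc huc (hcs.trans (hse.trans hev))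
    obtain ⟨w₂, hw₂, hew⟩ := hclose e he (huc.trans (hcs.trans hse)) hev
    obtain ⟨α, β, hα, hβ, hαβ, rfl⟩ := hw'
    have hdist : dist (α • γ c + β • γ e) (α • w₁ + β • w₂) ≤ √(8 / 3 * R k * d) := by
      rw [dist_eq_norm] at hcw hew ⊢
      calc ‖α • γ c + β • γ e - (α • w₁ + β • w₂)‖
          = ‖α • (γ c - w₁) + β • (γ e - w₂)‖ := by congr 1; module
        _ ≤ α * ‖γ c - w₁‖ + β * ‖γ e - w₂‖ := by
          refine (norm_add_le _ _).trans ?_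
          rw [norm_smul, norm_smul, Real.norm_of_nonneg hα, Real.norm_of_nonneg hβ]
        _ ≤ α * √(8 / 3 * R k * d) + β * √(8 / 3 * R k * d) := by gcongr
        _ = √(8 / 3 * R k * d) := by rw [← add_mul, hαβ, one_mul]
    refine ⟨α • w₁ + β • w₂, (convex_segment _ _) hw₁ hw₂ hα hβ hαβ, ?_⟩
    have hsq := Real.sq_sqrt (by positivity : 0 ≤ 8 / 3 * R k * d)
    have hmono := weightedIncrement_mono hfin huc (hcs.trans hse) hev hc he
    rw [weightedIncrement_succ hk]
    have htri := dist_triangle (γ s) (α • γ c + β • γ e) (α • w₁ + β • w₂)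
    have hn : 0 ≤ weightedIncrement γ L N Y a b (k + 1) u v := weightedIncrement_nonneg hfin _ _ _
    rw [h.R_succ] at hsw'
    have hfinal : 16 / 3 * (R k / 8) * weightedIncrement γ L N Y a b (k + 1) c e ≤
        16 / 3 * (R k / 8) * weightedIncrement γ L N Y a b (k + 1) u v := by gcongr
    have hpos := mul_nonneg hRk.le hn
    have hx0 : 0 ≤ dist (γ s) (α • γ c + β • γ e) := dist_nonneg
    have hy0 : 0 ≤ dist (α • γ c + β • γ e) (α • w₁ + β • w₂) := dist_nonneg
    generalize dist (γ s) (α • γ c + β • γ e) = x at *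
    generalize dist (α • γ c + β • γ e) (α • w₁ + β • w₂) = y at *
    calc dist (γ s) (α • w₁ + β • w₂) ^ 2 ≤ (x + y) ^ 2 := by gcongr
      _ ≤ 2 * x ^ 2 + 2 * y ^ 2 := by nlinarith [sq_nonneg (x - y)]
      _ ≤ 2 * x ^ 2 + 2 * √(8 / 3 * R k * d) ^ 2 := by gcongr
      _ ≤ _ := by rw [hsq]; linarith

/-- The arcs of a system can be enlarged slightly so that the squares of their deviations from the
segments joining their endpoints, weighted by scale, are controlled by the excess length. -/
theorem exists_enlargement (h : ArcSystem γ L N R Y a b)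
    (hlen : eVariationOn γ (Set.Icc 0 L) = ENNReal.ofReal L) :
    ∃ a' b' dev : ℕ → ι → ℝ,
      (∀ k < N, ∀ y ∈ Y k, 0 ≤ a' k y ∧ a' k y ≤ a k y ∧ b k y ≤ b' k y ∧ b' k y ≤ L ∧
        dist (γ (a' k y)) (γ (a k y)) ≤ R k / 6 ∧ dist (γ (b k y)) (γ (b' k y)) ≤ R k / 6 ∧
        0 ≤ dev k y ∧ ∀ s ∈ Set.Icc (a' k y) (b' k y),
          ∃ w ∈ segment ℝ (γ (a' k y)) (γ (b' k y)), dist (γ s) w ≤ dev k y) ∧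
      ∑ k ∈ Finset.range N, ∑ y ∈ Y k, dev k y ^ 2 / R k ≤ 32 / 3 * (L - dist (γ L) (γ 0)) := by
  have hfin : eVariationOn γ (Set.Icc 0 L) ≠ ⊤ := hlen ▸ ENNReal.ofReal_ne_top
  have hex : ∀ k y, ∃ a' b', k < N → y ∈ Y k →
      a' ∈ breakpoints L N Y a b k ∧ b' ∈ breakpoints L N Y a b k ∧ a' ≤ a k y ∧ b k y ≤ b' ∧
      (∀ x ∈ breakpoints L N Y a b k, x ≤ a k y → x ≤ a') ∧
      (∀ x ∈ breakpoints L N Y a b k, b k y ≤ x → b' ≤ x) := by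
    intro k y
    by_cases hky : k < N ∧ y ∈ Y k
    · have h1 := h.left_nonneg k hky.1 y hky.2
      have h2 := h.left_le k hky.1 y hky.2
      have h3 := h.right_le k hky.1 y hky.2
      obtain ⟨a', -, ha', -, haa', -, hmax, -⟩ := exists_isGap_around (isClosed_breakpoints k)
        (h.zero_mem k) (h.len_mem k) (s := a k y) ⟨h1, h2.trans h3⟩
      obtain ⟨-, b', -, hb', -, hbb', -, hmin⟩ := exists_isGap_around (isClosed_breakpoints k)
        (h.zero_mem k) (h.len_mem k) (s := b k y) ⟨h1.trans h2, h3⟩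
      exact ⟨a', b', fun _ _ => ⟨ha', hb', haa', hbb', hmax, hmin⟩⟩
    · exact ⟨0, 0, fun h1 h2 => absurd ⟨h1, h2⟩ hky⟩
  choose a' b' hab using hex
  have hgap : ∀ k < N, ∀ y ∈ Y k, IsGap (breakpoints L N Y a b k) (a' k y) (b' k y) := by
    intro k hk y hy
    obtain ⟨ha', hb', haa', hbb', hmax, hmin⟩ := hab k y hk hy
    refine ⟨ha', hb', haa'.trans ((h.left_le k hk y hy).trans hbb'), fun x hx => ?_⟩
    rcases le_or_gt x (a k y) with h1 | h1
    · exact Or.inl (hmax x hx h1)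
    · rcases le_or_gt (b k y) x with h2 | h2
      · exact Or.inr (hmin x hx h2)
      · exact absurd ⟨h1, h2⟩ (hx.2 k le_rfl hk y hy)
  set Ψ : ℕ → ι → ℝ := fun k y => weightedIncrement γ L N Y a b k (a' k y) (b' k y) with hΨ
  have hΨ0 : ∀ k y, 0 ≤ Ψ k y := fun k y => weightedIncrement_nonneg hfin _ _ _
  have hend : ∀ k (hk : k < N), ∀ y ∈ Y k, dist (γ (a' k y)) (γ (a k y)) ≤ R k / 6 ∧
      dist (γ (b k y)) (γ (b' k y)) ≤ R k / 6 := by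
    intro k hk y hy
    obtain ⟨ha', hb', haa', hbb', hmax, hmin⟩ := hab k y hk hy
    have ih := h.dist_le_of_isGap (k := k + 1) hk
    exact ⟨h.dist_le_left hk ih hy ha' haa' hmax _ ⟨le_rfl, haa'⟩ _ ⟨haa', le_rfl⟩,
      h.dist_le_right hk ih hy hb' hbb' hmin _ ⟨le_rfl, hbb'⟩ _ ⟨hbb', le_rfl⟩⟩
  refine ⟨a', b', fun k y => √(16 / 3 * R k * Ψ k y), ?_, ?_⟩
  · intro k hk y hy
    obtain ⟨ha', hb', haa', hbb', -, -⟩ := hab k y hk hy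
    refine ⟨ha'.1.1, haa', hbb', hb'.1.2, (hend k hk y hy).1, (hend k hk y hy).2,
      Real.sqrt_nonneg _, fun s hs => ?_⟩
    obtain ⟨w, hw, hsw⟩ := h.exists_mem_segment_of_isGap hfin hk.le _ _ (hgap k hk y hy) s hs
    exact ⟨w, hw, Real.le_sqrt_of_sq_le hsw⟩
  · have hlevel : ∀ k < N, ∑ y ∈ Y k, Ψ k y ≤ weightedIncrement γ L N Y a b k 0 L := by
      intro k hk
      refine sum_weightedIncrement_disjoint_le hfin (Y k) (a' k) (b' k)
        (fun y hy => (hab k y hk hy).1) (fun y hy => (hab k y hk hy).2.1)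
        (fun y hy => (hgap k hk y hy).2.2.1) ?_ L (h.len_mem k)
        (fun y hy => (hab k y hk hy).2.1.1.2)
      intro y hy y' hy' hne
      by_contra hcon
      push Not at hcon
      have g := hgap k hk y hy
      have g' := hgap k hk y' hy'
      have e1 := (g.2.2.2 _ g'.1).resolve_right (not_le.2 hcon.1)
      have e2 := (g'.2.2.2 _ g.1).resolve_right (not_le.2 hcon.2)
      have heq : a' k y = a' k y' := le_antisymm e2 e1
      have d1 := (hend k hk y hy).1
      have d2 := (hend k hk y' hy').1
      rw [← heq, dist_comm] at d2
      rw [dist_comm] at d1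
      have d3 := dist_triangle (γ (a k y)) (γ (a' k y)) (γ (a k y'))
      have d4 := h.lt_dist k hk y hy y' hy' hne _ ⟨le_rfl, h.left_le k hk y hy⟩ _
        ⟨le_rfl, h.left_le k hk y' hy'⟩
      rw [dist_comm (γ (a' k y))] at d3
      linarith [h.R_pos k]
    have hN : polygonLength γ L N Y a b N 0 L = L := by
      rw [polygonLength, breakpoints_last, Set.inter_self, hlen, ENNReal.toReal_ofReal h.len_nonneg]
    have h0 := dist_le_polygonLength hfin (h.zero_mem 0) (h.len_mem 0) h.len_nonneg
    rw [dist_comm] at h0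
    have hsum := sum_weightedIncrement_le (γ := γ) (L := L) (N := N) (Y := Y) (a := a) (b := b)
      hfin 0 L
    rw [hN] at hsum
    have hterm : ∀ k y, √(16 / 3 * R k * Ψ k y) ^ 2 / R k = 16 / 3 * Ψ k y := by
      intro k y
      have hRk := h.R_pos k
      rw [Real.sq_sqrt (mul_nonneg (by positivity) (hΨ0 k y))]
      field_simp
    simp only [hterm, ← Finset.mul_sum]
    have := Finset.sum_le_sum fun k hk => hlevel k (Finset.mem_range.1 hk)
    linarith

end ArcSystem

end Tree

section Exit

lemma exists_exit_right {f : ℝ → ℝ} {t L ρ : ℝ} (htL : t ≤ L) (hf : ContinuousOn f (Set.Icc t L))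
    (ht : f t < ρ) :
    ∃ b ∈ Set.Icc t L, (∀ s ∈ Set.Icc t b, f s ≤ ρ) ∧ (b = L ∨ f b = ρ) := by
  have hivt : ∀ s ∈ Set.Icc t L, ρ < f s → ∃ s' ∈ Set.Icc t s, f s' = ρ := fun s hs hlt =>
    intermediate_value_Icc hs.1 (hf.mono (Set.Icc_subset_Icc_right hs.2)) ⟨ht.le, hlt.le⟩
  have hK : IsCompact (Set.Icc t L ∩ f ⁻¹' {ρ}) :=
    isCompact_Icc.of_isClosed_subset (hf.preimage_isClosed_of_isClosed isClosed_Icc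
      isClosed_singleton) Set.inter_subset_left
  rcases (Set.Icc t L ∩ f ⁻¹' {ρ}).eq_empty_or_nonempty with hemp | hne
  · refine ⟨L, ⟨htL, le_rfl⟩, fun s hs => ?_, Or.inl rfl⟩
    by_contra hlt
    obtain ⟨s', hs', hfs'⟩ := hivt s hs (not_le.1 hlt)
    exact (Set.eq_empty_iff_forall_notMem.1 hemp s') ⟨⟨hs'.1, hs'.2.trans hs.2⟩, hfs'⟩
  · obtain ⟨b, ⟨hb, hfb⟩, hmin⟩ := hK.exists_isLeast hne
    refine ⟨b, hb, fun s hs => ?_, Or.inr hfb⟩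
    by_contra hlt
    obtain ⟨s', hs', hfs'⟩ := hivt s ⟨hs.1, hs.2.trans hb.2⟩ (not_le.1 hlt)
    have h1 : b ≤ s' := hmin ⟨⟨hs'.1, hs'.2.trans (hs.2.trans hb.2)⟩, hfs'⟩
    have h2 : s' = s := le_antisymm hs'.2 (hs.2.trans h1)
    exact hlt (h2 ▸ hfs'.le)

lemma exists_exit_interval {H : Type*} [PseudoMetricSpace H] {γ : ℝ → H} {L t ρ : ℝ}
    (hγ : ContinuousOn γ (Set.Icc 0 L)) (ht : t ∈ Set.Icc 0 L) (hρ : 0 < ρ) :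
    ∃ a b, 0 ≤ a ∧ a ≤ t ∧ t ≤ b ∧ b ≤ L ∧ (∀ s ∈ Set.Icc a b, dist (γ s) (γ t) ≤ ρ) ∧
      (a = 0 ∨ dist (γ a) (γ t) = ρ) ∧ (b = L ∨ dist (γ b) (γ t) = ρ) := by
  have hf : ContinuousOn (fun s => dist (γ s) (γ t)) (Set.Icc 0 L) := 
    (LipschitzWith.dist_left (γ t)).continuous.comp_continuousOn hγ
  obtain ⟨b, hb, hb1, hb2⟩ := exists_exit_right (ρ := ρ) ht.2
    (hf.mono (Set.Icc_subset_Icc_left ht.1)) (by simpa using hρ)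
  obtain ⟨a, ha, ha1, ha2⟩ := exists_exit_right (f := fun s => dist (γ (-s)) (γ t)) (t := -t)
    (L := 0) (ρ := ρ) (by linarith [ht.1])
    (hf.comp continuousOn_neg fun s hs =>
      ⟨by linarith [hs.2], by linarith [hs.1, ht.2]⟩) (by simpa using hρ)
  refine ⟨-a, b, by linarith [ha.2], by linarith [ha.1], hb.1, hb.2, fun s hs => ?_, ?_, hb2⟩
  · rcases le_total s t with h | h
    · simpa using ha1 (-s) ⟨by linarith, by linarith [hs.1]⟩
    · exact hb1 s ⟨h, hs.2⟩
  · exact ha2.imp (fun h => by simp [h]) id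

end Exit

section FlatGain

variable {H : Type*} [NormedAddCommGroup H] [InnerProductSpace ℝ H]

/-- A point of the curve far from a nearly straight piece of it forces fine covers to be longer
than coarse ones. -/
lemma flat_gain {γ : ℝ → H} {L : ℝ} (hγ : ContinuousOn γ (Set.Icc 0 L)) {a b s₀ z₀ : ℝ}
    (ha : 0 ≤ a) (hs₀ : s₀ ∈ Set.Icc a b) (hb : b ≤ L) (hz₀ : z₀ ∈ Set.Icc 0 L) {R h c : ℝ}
    (hdev : ∀ s ∈ Set.Icc a b, ∃ w ∈ segment ℝ (γ a) (γ b), dist (γ s) w ≤ h)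
    (hc : 0 < c) (hhc : 64 * h ≤ c) (hcR : c ≤ R)
    (hya : 4 * R ≤ dist (γ a) (γ s₀)) (hyb : 4 * R ≤ dist (γ b) (γ s₀))
    (hzy : dist (γ z₀) (γ s₀) < R) (hz : ∀ w ∈ segment ℝ (γ a) (γ b), c ≤ dist (γ z₀) w)
    {t : ℕ → Set H} (ht : γ '' Set.Icc 0 L ⊆ ⋃ n, t n)
    (hmesh : ∀ n, ediam (t n) ≤ ENNReal.ofReal (c / 32)) :
    ENNReal.ofReal (4 * R + 2 * (c / 32)) + ENNReal.ofReal (c / 4) ≤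
      ∑' n, {n | (t n ∩ (γ '' Set.Icc 0 L ∩ closedBall (γ s₀) (2 * R))).Nonempty}.indicator
        (fun n => ediam (t n)) n := by
  have hdist : ∀ n, ∀ u ∈ t n, ∀ v ∈ t n, dist u v ≤ c / 32 := by
    intro n u hu v hv
    have := (edist_le_ediam_of_mem hu hv).trans (hmesh n)
    rwa [edist_dist, ENNReal.ofReal_le_ofReal_iff (by positivity)] at this
  have hab : Set.Icc a b ⊆ Set.Icc 0 L := Set.Icc_subset_Icc ha hb
  have hab' : a ≤ b := hs₀.1.trans hs₀.2
  obtain ⟨w, hw, hyw⟩ := hdev s₀ hs₀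
  have hh : 0 ≤ h := dist_nonneg.trans hyw
  obtain ⟨α, β, hα, hβ, hαβ, rfl⟩ := hw
  have hne : γ b - γ a ≠ 0 := by
    intro h0
    have h1 : γ b = γ a := sub_eq_zero.1 h0
    rw [h1, ← add_smul, hαβ, one_smul, dist_comm] at hyw
    linarith
  set w := α • γ a + β • γ b with hwdef
  set D := ‖γ b - γ a‖ with hD
  have hDpos : 0 < D := norm_pos_iff.2 hne
  set u := (1 / D) • (γ b - γ a) with hu
  have hunorm : ‖u‖ = 1 := by
    rw [hu, norm_smul, Real.norm_of_nonneg (by positivity), ← hD]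
    field_simp
  have huu : inner ℝ u u = 1 := by rw [real_inner_self_eq_norm_sq, hunorm]; norm_num
  have hline : γ b - γ a = D • u := by
    rw [hu, smul_smul, mul_one_div_cancel hDpos.ne', one_smul]
  set f : H → ℝ := fun x => inner ℝ (x - w) u with hf
  have hfLip : LipschitzWith 1 f := by
    refine LipschitzWith.of_le_add fun x y => ?_
    have : f x - f y = inner ℝ (x - y) u := by
      rw [hf]
      simp only [← inner_sub_left]
      congr 1
      abel
    have h1 := real_inner_le_norm (x - y) u
    rw [hunorm, mul_one, ← dist_eq_norm] at h1
    linarith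
  have hfseg : ∀ x ∈ segment ℝ (γ a) (γ b), x - w = f x • u := by
    rintro x ⟨α', β', -, -, hαβ', rfl⟩
    have e : α' • γ a + β' • γ b - w = ((β' - β) * D) • u := by
      rw [mul_smul, ← hline, hwdef]
      obtain rfl : α' = 1 - β' := by linarith
      obtain rfl : α = 1 - β := by linarith
      module
    rw [hf]
    simp only [e, inner_smul_left, huu]
    simp
  have hfa : γ a - w = f (γ a) • u := hfseg _ (left_mem_segment ℝ _ _)
  have hfb : γ b - w = f (γ b) • u := hfseg _ (right_mem_segment ℝ _ _)
  have hfb0 : f (γ b) = α * D := by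
    have e : γ b - w = (α * D) • u := by
      rw [mul_smul, ← hline, hwdef]
      obtain rfl : α = 1 - β := by linarith
      module
    rw [hf]
    simp only [e, inner_smul_left, huu]
    simp
  have hfa0 : f (γ a) = -(β * D) := by
    have e : γ a - w = (-(β * D)) • u := by
      rw [neg_smul, mul_smul, ← hline, hwdef]
      obtain rfl : α = 1 - β := by linarith
      module
    rw [hf]
    simp only [e, inner_smul_left, huu]
    simp
  have hnb : dist (γ b) w = α * D := by
    rw [dist_eq_norm, hfb, norm_smul, hunorm, mul_one, hfb0, Real.norm_of_nonneg (by positivity)]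
  have hna : dist (γ a) w = β * D := by
    rw [dist_eq_norm, hfa, norm_smul, hunorm, mul_one, hfa0, norm_neg,
      Real.norm_of_nonneg (by positivity)]
  have hb4 : 4 * R - h ≤ f (γ b) := by
    have := dist_triangle (γ b) w (γ s₀)
    rw [dist_comm w] at this
    linarith
  have ha4 : f (γ a) ≤ -(4 * R - h) := by
    have := dist_triangle (γ a) w (γ s₀)
    rw [dist_comm w] at this
    linarith
  set N₁ : Set ℕ := {n | ∃ s ∈ Set.Icc a b, γ s ∈ t n ∧
    f (γ s) ∈ Set.Icc (-(2 * R - 3 * h)) (2 * R - 3 * h)} with hN₁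
  set N₂ : Set ℕ := {n | ∃ s ∈ Set.Icc 0 L, γ s ∈ t n ∧
    dist (γ s) (γ z₀) ∈ Set.Icc 0 (c / 2)} with hN₂
  have h1 := ofReal_sub_le_tsum_of_curve hγ ht hfLip (s₁ := a) (s₂ := b)
    (hab ⟨le_rfl, hab'⟩) (hab ⟨hab', le_rfl⟩) (p := -(2 * R - 3 * h)) (q := 2 * R - 3 * h) (N := N₁)
    (by linarith) (by linarith)
    (fun n s hs hn hfs => ⟨s, by rwa [Set.uIcc_of_le hab'] at hs, hn, hfs⟩)
  have h2 := ofReal_sub_le_tsum_of_curve hγ ht (LipschitzWith.dist_left (γ z₀)) (s₁ := z₀) (s₂ := s₀)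
    hz₀ (hab hs₀) (p := 0) (q := c / 2) (N := N₂) (by simp)
    (by
      have h3 := hz w ⟨α, β, hα, hβ, hαβ, rfl⟩
      have h4 := dist_triangle (γ z₀) (γ s₀) w
      rw [dist_comm (γ z₀) (γ s₀)] at h4
      linarith)
    (fun n s hs hn hfs => ⟨s, Set.uIcc_subset_Icc hz₀ (hab hs₀) hs, hn, hfs⟩)
  have hdisj : Disjoint N₁ N₂ := by
    rw [Set.disjoint_left]
    rintro n ⟨s, hs, hsn, -⟩ ⟨s', -, hsn', hs'⟩
    obtain ⟨x, hx, hsx⟩ := hdev s hs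
    have h3 := hdist n _ hsn' _ hsn
    have h4 := dist_triangle4 (γ z₀) (γ s') (γ s) x
    rw [dist_comm (γ z₀) (γ s')] at h4
    linarith [hz x hx, hs'.2]
  have hsub : N₁ ∪ N₂ ⊆
      {n | (t n ∩ (γ '' Set.Icc 0 L ∩ closedBall (γ s₀) (2 * R))).Nonempty} := by
    rintro n (⟨s, hs, hsn, hfs⟩ | ⟨s, hs, hsn, hs'⟩)
    · refine ⟨γ s, hsn, ⟨s, hab hs, rfl⟩, ?_⟩
      obtain ⟨x, hx, hsx⟩ := hdev s hs
      have h3 : dist x w = |f x| := by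
        rw [dist_eq_norm, hfseg x hx, norm_smul, hunorm, mul_one, Real.norm_eq_abs]
      have h4 : |f x - f (γ s)| ≤ h := by
        have := hfLip.dist_le_mul x (γ s)
        rw [Real.dist_eq, dist_comm] at this
        simpa using this.trans (by simpa using hsx)
      have h5 : |f x| ≤ 2 * R - 3 * h + h := by
        have h6 := abs_le.2 ⟨hfs.1, hfs.2⟩
        have h7 := abs_sub_abs_le_abs_sub (f x) (f (γ s))
        linarith
      have h6 := dist_triangle4 (γ s) x w (γ s₀)
      rw [dist_comm w] at h6
      rw [mem_closedBall]
      linarith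
    · refine ⟨γ s, hsn, ⟨s, hs, rfl⟩, ?_⟩
      rw [mem_closedBall]
      have h3 := dist_triangle (γ s) (γ z₀) (γ s₀)
      linarith [hs'.2]
  calc ENNReal.ofReal (4 * R + 2 * (c / 32)) + ENNReal.ofReal (c / 4)
      = ENNReal.ofReal (4 * R + 2 * (c / 32) + c / 4) :=
        (ENNReal.ofReal_add (by linarith) (by linarith)).symm
    _ ≤ ENNReal.ofReal ((2 * R - 3 * h - -(2 * R - 3 * h)) + (c / 2 - 0)) :=
        ENNReal.ofReal_le_ofReal (by linarith)
    _ = ENNReal.ofReal (2 * R - 3 * h - -(2 * R - 3 * h)) + ENNReal.ofReal (c / 2 - 0) :=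
        ENNReal.ofReal_add (by linarith) (by linarith)
    _ ≤ _ := add_le_add h1 h2
    _ = ∑' n, (N₁ ∪ N₂).indicator (fun n => ediam (t n)) n := by
        rw [← ENNReal.tsum_add, Set.indicator_union_of_disjoint hdisj]
    _ ≤ _ := ENNReal.tsum_le_tsum fun n =>
        Set.indicator_le_indicator_of_subset hsub (fun _ => zero_le) n

end FlatGain

section JonesBeta

variable {H : Type*} [NormedAddCommGroup H] [InnerProductSpace ℝ H]

lemma jonesBeta_nonneg (Γ Q : Set H) : 0 ≤ jonesBeta Γ Q := by
  refine mul_nonneg (by positivity) (Real.sInf_nonneg ?_)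
  rintro _ ⟨p, v, -, rfl⟩
  refine Real.sSup_nonneg ?_
  rintro _ ⟨x, -, rfl⟩
  exact infDist_nonneg

lemma jonesBeta_ball_le {Γ : Set H} {y p v : H} {R b : ℝ} (hR : 0 < R) (hb : 0 ≤ b) (hv : v ≠ 0)
    (h : ∀ z ∈ ball y R ∩ Γ, infDist z (lineThrough p v) ≤ b * R) :
    jonesBeta Γ (ball y R) ≤ b := by
  have : Nontrivial H := nontrivial_of_ne v 0 hv
  have h1 : sInf {r : ℝ | ∃ p v : H, v ≠ 0 ∧
      r = sSup ((fun x => infDist x (lineThrough p v)) '' (ball y R ∩ Γ))} ≤ b * R := by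
    refine csInf_le_of_le ⟨0, ?_⟩ ⟨p, v, hv, rfl⟩ (Real.sSup_le ?_ (by positivity))
    · rintro _ ⟨p, v, -, rfl⟩
      refine Real.sSup_nonneg ?_
      rintro _ ⟨x, -, rfl⟩
      exact infDist_nonneg
    · rintro _ ⟨x, hx, rfl⟩
      exact h x hx
  rw [jonesBeta, diam_ball_eq y hR.le]
  calc 2 / (2 * R) * _ ≤ 2 / (2 * R) * (b * R) := by gcongr
    _ = b := by field_simp

lemma jonesBeta_of_subsingleton [Subsingleton H] (Γ Q : Set H) : jonesBeta Γ Q = 0 := by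
  have : {r : ℝ | ∃ p v : H, v ≠ 0 ∧
      r = sSup ((fun x => infDist x (lineThrough p v)) '' (Q ∩ Γ))} = ∅ :=
    Set.eq_empty_iff_forall_notMem.2 fun _ ⟨_, v, hv, _⟩ => hv (Subsingleton.elim v 0)
  rw [jonesBeta, this, Real.sInf_empty, mul_zero]

lemma jonesBeta_ball_le_one (Γ : Set H) (y : H) {R : ℝ} (hR : 0 < R) :
    jonesBeta Γ (ball y R) ≤ 1 := by
  rcases subsingleton_or_nontrivial H with h | h
  · rw [jonesBeta_of_subsingleton]
    exact zero_le_one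
  · obtain ⟨v, hv⟩ := exists_ne (0 : H)
    refine jonesBeta_ball_le (p := y) hR zero_le_one hv fun z hz => ?_
    have hy : y ∈ lineThrough y v := ⟨0, by simp⟩
    rw [one_mul]
    exact (infDist_le_dist_of_mem hy).trans (mem_ball.1 hz.1).le

/-- If the beta number of a ball is large, the set has a point far from any given segment. -/
lemma exists_far_of_lt_jonesBeta {Γ : Set H} {y : H} {R b : ℝ} (hR : 0 < R) (hb : 0 ≤ b)
    (h : b < jonesBeta Γ (ball y R)) (p q : H) :
    ∃ z ∈ ball y R ∩ Γ, ∀ w ∈ segment ℝ p q, b * R ≤ dist z w := by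
  have : Nontrivial H := by
    by_contra hcon
    rw [not_nontrivial_iff_subsingleton] at hcon
    rw [jonesBeta_of_subsingleton] at h
    linarith
  obtain ⟨v, hv, hseg⟩ : ∃ v : H, v ≠ 0 ∧ segment ℝ p q ⊆ lineThrough p v := by
    rw [segment_eq_image']
    rcases eq_or_ne q p with rfl | hne
    · obtain ⟨v, hv⟩ := exists_ne (0 : H)
      refine ⟨v, hv, ?_⟩
      rintro _ ⟨t, -, rfl⟩
      exact ⟨0, by simp⟩
    · refine ⟨q - p, sub_ne_zero.2 hne, ?_⟩
      rintro _ ⟨t, -, rfl⟩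
      exact ⟨t, rfl⟩
  by_contra! hcon
  refine absurd h (not_lt.2 (jonesBeta_ball_le (p := p) hR hb hv fun z hz => ?_))
  obtain ⟨w, hw, hzw⟩ := hcon z hz
  exact (infDist_le_dist_of_mem (hseg hw)).trans hzw.le

end JonesBeta

section Sums

lemma sum_range_sub_add_le {G : ℕ → ℝ} {m M : ℝ} (hm : ∀ k, m ≤ G k) (hM : ∀ k, G k ≤ M)
    (N q : ℕ) : ∑ k ∈ Finset.range N, (G (k + q) - G k) ≤ q * (M - m) := by
  induction q with
  | zero => simp
  | succ q ih =>
    have h1 : ∑ k ∈ Finset.range N, (G (k + (q + 1)) - G (k + q)) = G (N + q) - G q := by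
      have := Finset.sum_range_sub (fun k => G (k + q)) N
      simpa [add_right_comm, add_assoc, add_comm 1 q] using this
    have h2 : ∑ k ∈ Finset.range N, (G (k + (q + 1)) - G k) =
        ∑ k ∈ Finset.range N, (G (k + (q + 1)) - G (k + q)) +
          ∑ k ∈ Finset.range N, (G (k + q) - G k) := by
      rw [← Finset.sum_add_distrib]
      exact Finset.sum_congr rfl fun k _ => by ring
    rw [h2, h1]
    push_cast
    linarith [hM (N + q), hm q]

lemma sum_geometric_ite_le {e : ℝ} (he : 0 ≤ e) (N : ℕ) : ∀ R : ℝ, 0 ≤ R →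
    ∑ k ∈ Finset.range N, (if R / 8 ^ k ≤ e then R / 8 ^ k else 0) ≤ 2 * min e R := by
  induction N with
  | zero =>
    intro R hR
    simp [he, hR]
  | succ N ih =>
    intro R hR
    have h1 := ih (R / 8) (by positivity)
    rw [Finset.sum_range_succ']
    have h2 : ∀ k : ℕ, R / 8 ^ (k + 1) = R / 8 / 8 ^ k := fun k => by
      rw [pow_succ]
      field_simp
    simp only [h2, pow_zero, div_one]
    have h3 := min_le_left e (R / 8)
    have h4 := min_le_right e (R / 8)
    rcases le_total e R with h | h
    · rw [min_eq_left h]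
      split_ifs with h5 <;> linarith
    · rw [min_eq_right h, if_pos h]
      linarith

lemma sum_add_div_two_pow_le (N : ℕ) :
    ∑ M ∈ Finset.range N, ((M : ℝ) + 7) * (1 / 2) ^ M ≤ 16 := by
  have h : ∑ M ∈ Finset.range N, ((M : ℝ) + 7) * (1 / 2) ^ M
      = 16 - (2 * N + 16) * (1 / 2) ^ N := by
    induction N with
    | zero => simp
    | succ N ih =>
      rw [Finset.sum_range_succ, ih]
      push_cast
      ring
  rw [h]
  have : (0 : ℝ) ≤ (2 * N + 16) * (1 / 2) ^ N := by positivity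
  linarith

end Sums

section Excess

variable {H : Type*} [NormedAddCommGroup H] [InnerProductSpace ℝ H] {γ : ℝ → H} {L : ℝ}

lemma IsArclengthParam.dist_le (hγ : IsArclengthParam γ L) {s t : ℝ} (hs : 0 ≤ s) (hst : s ≤ t)
    (ht : t ≤ L) : dist (γ s) (γ t) ≤ t - s := by
  have := hγ.lip.dist_le_mul s ⟨hs, hst.trans ht⟩ t ⟨hs.trans hst, ht⟩
  rwa [NNReal.coe_one, one_mul, Real.dist_eq, abs_sub_comm, abs_of_nonneg (sub_nonneg.2 hst)]
    at this

/-- The excess of a subarc is at most the excess of the arc. -/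
lemma IsArclengthParam.sub_dist_le (hγ : IsArclengthParam γ L) {s t : ℝ} (hs : 0 ≤ s)
    (hst : s ≤ t) (ht : t ≤ L) : t - s - dist (γ s) (γ t) ≤ L - dist (γ L) (γ 0) := by
  have h1 := hγ.dist_le le_rfl hs (hst.trans ht)
  have h2 := hγ.dist_le (hs.trans hst) ht le_rfl
  have h3 := dist_triangle4 (γ 0) (γ s) (γ t) (γ L)
  rw [dist_comm (γ L)]
  linarith

lemma IsArclengthParam.excess_nonneg (hγ : IsArclengthParam γ L) : 0 ≤ L - dist (γ L) (γ 0) := by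
  have := hγ.sub_dist_le le_rfl le_rfl hγ.len_nonneg
  simpa using this

/-- The finite length version of `coverLength`, for arcs. -/
noncomputable def coverLengthReal (Γ : Set H) (δ : ℝ) : ℝ := (coverLength Γ δ).toReal

lemma IsArclengthParam.coverLength_ne_top (hγ : IsArclengthParam γ L) {δ : ℝ} (hδ : 0 < δ) :
    coverLength (γ '' Set.Icc 0 L) δ ≠ ⊤ :=
  ne_top_of_le_ne_top ENNReal.ofReal_ne_top (coverLength_le_ofReal hγ.len_nonneg hγ.lip hδ)

lemma IsArclengthParam.coverLengthReal_le (hγ : IsArclengthParam γ L) {δ : ℝ} (hδ : 0 < δ) :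
    coverLengthReal (γ '' Set.Icc 0 L) δ ≤ L :=
  ENNReal.toReal_le_of_le_ofReal hγ.len_nonneg (coverLength_le_ofReal hγ.len_nonneg hγ.lip hδ)

lemma IsArclengthParam.le_coverLengthReal (hγ : IsArclengthParam γ L) {δ : ℝ} (hδ : 0 < δ) :
    dist (γ L) (γ 0) ≤ coverLengthReal (γ '' Set.Icc 0 L) δ :=
  (ENNReal.ofReal_le_iff_le_toReal (hγ.coverLength_ne_top hδ)).1
    (ofReal_dist_le_coverLength hγ.len_nonneg hγ.lip.continuousOn δ)

lemma IsArclengthParam.coverLengthReal_anti (hγ : IsArclengthParam γ L) {δ δ' : ℝ} (hδ' : 0 < δ')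
    (h : δ' ≤ δ) : coverLengthReal (γ '' Set.Icc 0 L) δ ≤ coverLengthReal (γ '' Set.Icc 0 L) δ' :=
  ENNReal.toReal_mono (hγ.coverLength_ne_top hδ') (coverLength_antitone _ h)

/-- Real version of `coverLength_add_le` for arcs. -/
lemma IsArclengthParam.coverLengthReal_add_le (hγ : IsArclengthParam γ L) {δ δ' : ℝ}
    (hδ' : 0 < δ') (hδδ' : δ' ≤ δ) {ι : Type*} (Y : Finset ι) (S : ι → Set H) (Δ g : ι → ℝ)
    (hg : ∀ y ∈ Y, 0 ≤ g y)
    (hsep : ∀ y ∈ Y, ∀ y' ∈ Y, y ≠ y' → ∀ u ∈ S y, ∀ v ∈ S y', δ' < dist u v)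
    (hdiam : ∀ y ∈ Y, ∀ u ∈ S y, ∀ v ∈ S y, dist u v + 2 * δ' ≤ Δ y)
    (hΔ : ∀ y ∈ Y, Δ y ≤ δ)
    (hlow : ∀ y ∈ Y, ∀ t : ℕ → Set H, γ '' Set.Icc 0 L ⊆ ⋃ n, t n →
      (∀ n, ediam (t n) ≤ ENNReal.ofReal δ') →
      ENNReal.ofReal (Δ y) + ENNReal.ofReal (g y) ≤
        ∑' n, {n | (t n ∩ S y).Nonempty}.indicator (fun n => ediam (t n)) n) :
    coverLengthReal (γ '' Set.Icc 0 L) δ + ∑ y ∈ Y, g y ≤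
      coverLengthReal (γ '' Set.Icc 0 L) δ' := by
  have h := coverLength_add_le hδ'.le hδδ' Y S Δ (fun y => ENNReal.ofReal (g y)) hsep hdiam hΔ hlow
  rw [← ENNReal.ofReal_sum_of_nonneg hg] at h
  have h1 := ENNReal.toReal_mono (hγ.coverLength_ne_top hδ') h
  rwa [ENNReal.toReal_add (hγ.coverLength_ne_top (hδ'.trans_le hδδ')) ENNReal.ofReal_ne_top,
    ENNReal.toReal_ofReal (Finset.sum_nonneg hg)] at h1

end Excess

section SeparatedBalls

variable {H : Type*} [NormedAddCommGroup H] [InnerProductSpace ℝ H] {γ : ℝ → H} {L : ℝ}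

lemma IsArclengthParam.sum_flat_le (hγ : IsArclengthParam γ L) {R₀ : ℝ} (hR₀ : 0 < R₀) (N : ℕ)
    (Y : ℕ → Finset H) (m : ℕ → H → ℕ)
    (hsep : ∀ k < N, ∀ y ∈ Y k, ∀ y' ∈ Y k, y ≠ y' → 24 * (R₀ / 8 ^ k) < dist y y')
    (hlow : ∀ k < N, ∀ y ∈ Y k, ∀ t : ℕ → Set H, γ '' Set.Icc 0 L ⊆ ⋃ n, t n →
      (∀ n, ediam (t n) ≤ ENNReal.ofReal ((1 / 2) ^ (m k y + 1) * (R₀ / 8 ^ k) / 32)) →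
      ENNReal.ofReal (4 * (R₀ / 8 ^ k) + 2 * ((1 / 2) ^ (m k y + 1) * (R₀ / 8 ^ k) / 32)) +
          ENNReal.ofReal ((1 / 2) ^ (m k y + 1) * (R₀ / 8 ^ k) / 4) ≤
        ∑' n, {n | (t n ∩ (γ '' Set.Icc 0 L ∩ closedBall y (2 * (R₀ / 8 ^ k)))).Nonempty}.indicator
          (fun n => ediam (t n)) n) :
    ∑ k ∈ Finset.range N, ∑ y ∈ Y k, ((1 / 2) ^ m k y) ^ 2 * (R₀ / 8 ^ k) ≤
      128 * (L - dist (γ L) (γ 0)) := by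
  classical
  set E := L - dist (γ L) (γ 0) with hE
  have hE0 : 0 ≤ E := hγ.excess_nonneg
  have hR : ∀ k, 0 < R₀ / 8 ^ k := fun k => by positivity
  set G : ℕ → ℝ := fun k => coverLengthReal (γ '' Set.Icc 0 L) (8 * (R₀ / 8 ^ k)) with hG
  have hlevel : ∀ M, ∀ k < N, ∑ y ∈ Y k with m k y = M, (1 / 2) ^ (M + 1) * (R₀ / 8 ^ k) / 4 ≤
      G (k + (M + 7)) - G k := by
    intro M k hk
    have hc1 : (1 / 2 : ℝ) ^ (M + 1) ≤ 1 := pow_le_one₀ (by norm_num) (by norm_num)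
    have hc : (1 / 2 : ℝ) ^ (M + 1) * (R₀ / 8 ^ k) ≤ R₀ / 8 ^ k :=
      mul_le_of_le_one_left (hR k).le hc1
    have hRk := hR k
    have h1 := hγ.coverLengthReal_add_le (δ := 8 * (R₀ / 8 ^ k))
      (δ' := (1 / 2) ^ (M + 1) * (R₀ / 8 ^ k) / 32) (by positivity) (by linarith)
      {y ∈ Y k | m k y = M} (fun y => γ '' Set.Icc 0 L ∩ closedBall y (2 * (R₀ / 8 ^ k)))
      (fun _ => 4 * (R₀ / 8 ^ k) + 2 * ((1 / 2) ^ (M + 1) * (R₀ / 8 ^ k) / 32))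
      (fun _ => (1 / 2) ^ (M + 1) * (R₀ / 8 ^ k) / 4) (fun _ _ => by positivity)
      (fun y hy y' hy' hne u hu v hv => by
        have h2 := hsep k hk y (Finset.mem_filter.1 hy).1 y' (Finset.mem_filter.1 hy').1 hne
        have h3 := mem_closedBall'.1 hu.2
        have h4 := mem_closedBall.1 hv.2
        have h5 := dist_triangle4 y u v y'
        linarith)
      (fun y _ u hu v hv => by
        have h3 := mem_closedBall.1 hu.2
        have h4 := mem_closedBall'.1 hv.2
        have h5 := dist_triangle u y v
        linarith)
      (fun _ _ => by linarith)
      (fun y hy t ht hmesh => by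
        obtain ⟨hyk, rfl⟩ := Finset.mem_filter.1 hy
        exact hlow k hk y hyk t ht hmesh)
    have h2 : G (k + (M + 7)) ≥ coverLengthReal (γ '' Set.Icc 0 L)
        ((1 / 2) ^ (M + 1) * (R₀ / 8 ^ k) / 32) := by
      refine hγ.coverLengthReal_anti (by positivity) ?_
      have e1 : 8 * (R₀ / 8 ^ (k + (M + 7))) = (1 / 8) ^ (M + 6) * (R₀ / 8 ^ k) := by
        rw [one_div, inv_pow]
        field_simp
        ring
      have e2 : (1 / 2 : ℝ) ^ (M + 1) * (R₀ / 8 ^ k) / 32 = (1 / 2) ^ (M + 6) * (R₀ / 8 ^ k) := by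
        rw [pow_add, pow_add (1 / 2 : ℝ) M 6]
        ring
      rw [e1, e2]
      gcongr
      norm_num
    linarith
  have hclass : ∀ M, ∑ k ∈ Finset.range N, ∑ y ∈ Y k with m k y = M,
      ((1 / 2) ^ m k y) ^ 2 * (R₀ / 8 ^ k) ≤ 8 * E * (((M : ℝ) + 7) * (1 / 2) ^ M) := by
    intro M
    have h1 : ∑ k ∈ Finset.range N, ∑ y ∈ Y k with m k y = M,
        (1 / 2) ^ (M + 1) * (R₀ / 8 ^ k) / 4 ≤ ((M : ℝ) + 7) * E := by
      refine (Finset.sum_le_sum fun k hk => hlevel M k (Finset.mem_range.1 hk)).trans ?_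
      have := sum_range_sub_add_le (G := G)
        (fun k => hγ.le_coverLengthReal (mul_pos (by norm_num) (hR k)))
        (fun k => hγ.coverLengthReal_le (mul_pos (by norm_num) (hR k))) N (M + 7)
      simpa using this
    have h2 : ∑ k ∈ Finset.range N, ∑ y ∈ Y k with m k y = M,
        ((1 / 2) ^ m k y) ^ 2 * (R₀ / 8 ^ k) = 8 * (1 / 2) ^ M *
          ∑ k ∈ Finset.range N, ∑ y ∈ Y k with m k y = M,
            (1 / 2) ^ (M + 1) * (R₀ / 8 ^ k) / 4 := by
      rw [Finset.mul_sum]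
      refine Finset.sum_congr rfl fun k _ => ?_
      rw [Finset.mul_sum]
      refine Finset.sum_congr rfl fun y hy => ?_
      rw [(Finset.mem_filter.1 hy).2]
      ring
    rw [h2]
    calc 8 * (1 / 2 : ℝ) ^ M * _ ≤ 8 * (1 / 2 : ℝ) ^ M * (((M : ℝ) + 7) * E) := by gcongr
      _ = _ := by ring
  set K := (Finset.range N).sup (fun k => (Y k).sup (m k)) + 1 with hK
  have hmK : ∀ k ∈ Finset.range N, ∀ y ∈ Y k, m k y ∈ Finset.range K := by
    intro k hk y hy
    rw [Finset.mem_range, hK, Nat.lt_succ_iff]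
    exact (Finset.le_sup (f := m k) hy).trans
      (Finset.le_sup (f := fun k => (Y k).sup (m k)) hk)
  calc ∑ k ∈ Finset.range N, ∑ y ∈ Y k, ((1 / 2) ^ m k y) ^ 2 * (R₀ / 8 ^ k)
      = ∑ k ∈ Finset.range N, ∑ M ∈ Finset.range K, ∑ y ∈ Y k with m k y = M,
          ((1 / 2) ^ m k y) ^ 2 * (R₀ / 8 ^ k) :=
        Finset.sum_congr rfl fun k hk => (Finset.sum_fiberwise_of_maps_to (hmK k hk) _).symm
    _ = ∑ M ∈ Finset.range K, ∑ k ∈ Finset.range N, ∑ y ∈ Y k with m k y = M,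
          ((1 / 2) ^ m k y) ^ 2 * (R₀ / 8 ^ k) := Finset.sum_comm
    _ ≤ ∑ M ∈ Finset.range K, 8 * E * (((M : ℝ) + 7) * (1 / 2) ^ M) :=
        Finset.sum_le_sum fun M _ => hclass M
    _ ≤ 8 * E * 16 := by
        rw [← Finset.mul_sum]
        gcongr
        exact sum_add_div_two_pow_le K
    _ = 128 * E := by ring

/-- Far points whose parameters lie beyond an exit of a ball force a large excess. -/
lemma IsArclengthParam.le_excess_of_exit (hγ : IsArclengthParam γ L) {s b z R : ℝ} (hs : 0 ≤ s)
    (hsb : s ≤ b) (hbz : b ≤ z) (hz : z ≤ L) (hb : dist (γ b) (γ s) = 6 * R)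
    (hzs : dist (γ z) (γ s) < R) : R ≤ L - dist (γ L) (γ 0) := by
  have h1 := hγ.dist_le hs hsb (hbz.trans hz)
  have h2 := hγ.sub_dist_le hs (hsb.trans hbz) hz
  rw [dist_comm] at h1
  rw [dist_comm (γ s)] at h2
  have h3 : 0 ≤ dist (γ z) (γ s) := dist_nonneg
  linarith

lemma IsArclengthParam.le_excess_of_exit' (hγ : IsArclengthParam γ L) {s a z R : ℝ} (hs : s ≤ L)
    (has : a ≤ s) (hza : z ≤ a) (hz : 0 ≤ z) (ha : dist (γ a) (γ s) = 6 * R)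
    (hzs : dist (γ z) (γ s) < R) : R ≤ L - dist (γ L) (γ 0) := by
  have h1 := hγ.dist_le (hz.trans hza) has hs
  have h2 := hγ.sub_dist_le hz (hza.trans has) hs
  have h3 : 0 ≤ dist (γ z) (γ s) := dist_nonneg
  linarith

lemma sum_ite_le_of_forall_eq {ι : Type*} (Y : Finset ι) (P : ι → Prop) [DecidablePred P] {r : ℝ}
    (hr : 0 ≤ r) (h : ∀ y ∈ Y, ∀ y' ∈ Y, P y → P y' → y = y') :
    ∑ y ∈ Y, (if P y then r else 0) ≤ r := by
  rw [← Finset.sum_filter, Finset.sum_const, nsmul_eq_mul]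
  have : (Y.filter P).card ≤ 1 := Finset.card_le_one.2 fun y hy y' hy' =>
    h y (Finset.mem_filter.1 hy).1 y' (Finset.mem_filter.1 hy').1 (Finset.mem_filter.1 hy).2
      (Finset.mem_filter.1 hy').2
  have : ((Y.filter P).card : ℝ) ≤ 1 := by exact_mod_cast this
  nlinarith

/-- The beta sum over balls which are well separated at each scale. -/
theorem IsArclengthParam.sum_jonesBeta_sq_le (hγ : IsArclengthParam γ L) {R₀ : ℝ} (hR₀ : 0 < R₀)
    (N : ℕ) (Y : ℕ → Finset H) (hY : ∀ k < N, ∀ y ∈ Y k, y ∈ γ '' Set.Icc 0 L)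
    (hsep : ∀ k < N, ∀ y ∈ Y k, ∀ y' ∈ Y k, y ≠ y' → 24 * (R₀ / 8 ^ k) < dist y y') :
    ∑ k ∈ Finset.range N, ∑ y ∈ Y k,
        jonesBeta (γ '' Set.Icc 0 L) (ball y (R₀ / 8 ^ k)) ^ 2 * (R₀ / 8 ^ k) ≤
      3000000 * (L - dist (γ L) (γ 0)) := by
  classical
  set Γ := γ '' Set.Icc 0 L with hΓ
  set E := L - dist (γ L) (γ 0) with hE
  have hE0 : 0 ≤ E := hγ.excess_nonneg
  set R : ℕ → ℝ := fun k => R₀ / 8 ^ k with hRdef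
  have hR : ∀ k, 0 < R k := fun k => by positivity
  have hsepR : ∀ k < N, ∀ y ∈ Y k, ∀ y' ∈ Y k, y ≠ y' → 24 * R k < dist y y' := hsep
  have hcont := hγ.lip.continuousOn
  have hexit : ∀ k y, ∃ s a b, k < N → y ∈ Y k → γ s = y ∧ 0 ≤ a ∧ a ≤ s ∧ s ≤ b ∧ b ≤ L ∧
      (∀ s' ∈ Set.Icc a b, dist (γ s') y ≤ 6 * R k) ∧ (a = 0 ∨ dist (γ a) y = 6 * R k) ∧
      (b = L ∨ dist (γ b) y = 6 * R k) := by
    intro k y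
    by_cases hky : k < N ∧ y ∈ Y k
    · obtain ⟨s, hs, rfl⟩ := hY k hky.1 y hky.2
      obtain ⟨a, b, hab⟩ := exists_exit_interval (ρ := 6 * R k) hcont hs (by linarith [hR k])
      exact ⟨s, a, b, fun _ _ => ⟨rfl, hab⟩⟩
    · exact ⟨0, 0, 0, fun h1 h2 => absurd ⟨h1, h2⟩ hky⟩
  choose s a b hsab using hexit
  have hsys : ArcSystem γ L N (fun k => 12 * R k) Y a b := by
    refine ⟨hγ.len_nonneg, fun k => by linarith [hR k], fun k => ?_, ?_, ?_, ?_, ?_, ?_⟩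
    · simp only [hRdef, pow_succ]
      field_simp
    · intro k hk y hy
      exact (hsab k y hk hy).2.1
    · intro k hk y hy
      exact (hsab k y hk hy).2.2.1.trans (hsab k y hk hy).2.2.2.1
    · intro k hk y hy
      exact (hsab k y hk hy).2.2.2.2.1
    · intro k hk y hy u hu v hv
      have h1 := (hsab k y hk hy).2.2.2.2.2.1 u hu
      have h2 := (hsab k y hk hy).2.2.2.2.2.1 v hv
      linarith [dist_triangle_right (γ u) (γ v) y]
    · intro k hk y hy y' hy' hne u hu v hv
      have h1 := (hsab k y hk hy).2.2.2.2.2.1 u hu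
      have h2 := (hsab k y' hk hy').2.2.2.2.2.1 v hv
      have h3 := hsepR k hk y hy y' hy' hne
      have h4 := dist_triangle4 y (γ u) (γ v) y'
      rw [dist_comm y (γ u)] at h4
      linarith
  obtain ⟨a', b', dev, hdev, hdevsum⟩ := hsys.exists_enlargement
    (by rw [hγ.arclen 0 L le_rfl hγ.len_nonneg le_rfl, sub_zero])
  set β : ℕ → H → ℝ := fun k y => jonesBeta Γ (ball y (R k)) with hβ
  have hβ0 : ∀ k y, 0 ≤ β k y := fun k y => jonesBeta_nonneg _ _
  have hm : ∀ k y, ∃ m : ℕ, 0 < β k y → (1 / 2) ^ (m + 1) < β k y ∧ β k y ≤ (1 / 2) ^ m := by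
    intro k y
    by_cases hpos : 0 < β k y
    · obtain ⟨m, hm⟩ := exists_nat_pow_near_of_lt_one hpos (jonesBeta_ball_le_one Γ y (hR k))
        (by norm_num : (0 : ℝ) < 1 / 2) (by norm_num)
      exact ⟨m, fun _ => hm⟩
    · exact ⟨0, fun h => absurd h hpos⟩
  choose m hm using hm
  set F : ℕ → H → Prop := fun k y => 0 < β k y ∧ 64 * dev k y ≤ (1 / 2) ^ (m k y + 1) * R k ∧
    dist (γ (a k y)) y = 6 * R k ∧ dist (γ (b k y)) y = 6 * R k with hF
  have hbound : ∀ k < N, ∀ y ∈ Y k, β k y ^ 2 * R k ≤ 196608 * (dev k y ^ 2 / (12 * R k)) +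
      (if F k y then ((1 / 2) ^ m k y) ^ 2 * R k else 0) +
      ((if a k y = 0 then (if R k ≤ E then R k else 0) else 0) +
        (if b k y = L then (if R k ≤ E then R k else 0) else 0)) := by
    intro k hk y hy
    have hRk := hR k
    have hD0 : 0 ≤ 196608 * (dev k y ^ 2 / (12 * R k)) := by positivity
    have hite : 0 ≤ (if R k ≤ E then R k else 0) := by split_ifs <;> linarith
    have hA0 : 0 ≤ (if a k y = 0 then (if R k ≤ E then R k else 0) else 0) := by
      split_ifs <;> linarith
    have hB0 : 0 ≤ (if b k y = L then (if R k ≤ E then R k else 0) else 0) := by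
      split_ifs <;> linarith
    have hF0 : 0 ≤ (if F k y then ((1 / 2) ^ m k y) ^ 2 * R k else 0) := by
      split_ifs <;> positivity
    rcases (hβ0 k y).eq_or_lt with hzero | hpos
    · have : β k y ^ 2 * R k = 0 := by
        rw [← hzero]
        ring
      linarith
    obtain ⟨hm1, hm2⟩ := hm k y hpos
    have hsq : β k y ^ 2 * R k ≤ ((1 / 2) ^ m k y) ^ 2 * R k := by gcongr
    by_cases hflat : 64 * dev k y ≤ (1 / 2) ^ (m k y + 1) * R k
    · by_cases hboth : dist (γ (a k y)) y = 6 * R k ∧ dist (γ (b k y)) y = 6 * R k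
      · rw [if_pos (show F k y from ⟨hpos, hflat, hboth.1, hboth.2⟩)]
        linarith
      · obtain ⟨hsy, ha0, has, hsb, hbL, -, ha, hb⟩ := hsab k y hk hy
        obtain ⟨ha'0, ha'a, hbb', hb'L, -, -, -, hseg⟩ := hdev k hk y hy
        obtain ⟨z, ⟨hzball, z₀, hz₀, rfl⟩, hzfar⟩ := exists_far_of_lt_jonesBeta hRk
          (by positivity) hm1 (γ (a' k y)) (γ (b' k y))
        rw [mem_ball, ← hsy] at hzball
        have hout : z₀ < a' k y ∨ b' k y < z₀ := by
          by_contra! hcon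
          obtain ⟨w, hw, hzw⟩ := hseg z₀ hcon
          have h1 := hzfar w hw
          have h2 : 0 < (1 / 2) ^ (m k y + 1) * R k := by positivity
          linarith
        have hRE : R k ≤ E := by
          rcases hout with hout | hout
          · have ha2 : dist (γ (a k y)) (γ (s k y)) = 6 * R k := by
              rw [hsy]
              exact ha.resolve_left fun h => by linarith [hz₀.1]
            exact hγ.le_excess_of_exit' (hsb.trans hbL) has (hout.le.trans ha'a) hz₀.1 ha2 hzball
          · have hb2 : dist (γ (b k y)) (γ (s k y)) = 6 * R k := by
              rw [hsy]
              exact hb.resolve_left fun h => by linarith [hz₀.2]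
            exact hγ.le_excess_of_exit (ha0.trans has) hsb (hbb'.trans hout.le) hz₀.2 hb2 hzball
        have hone : β k y ^ 2 * R k ≤ R k := by
          have h1 : β k y ≤ 1 := jonesBeta_ball_le_one Γ y hRk
          exact mul_le_of_le_one_left hRk.le (pow_le_one₀ (hβ0 k y) h1)
        rw [if_pos hRE] at hA0 hB0 ⊢
        rcases ha with ha | ha
        · rw [if_pos ha]
          linarith
        · rcases hb with hb | hb
          · rw [if_pos hb]
            linarith
          · exact absurd ⟨ha, hb⟩ hboth
    · push Not at hflat
      have h1 : (1 / 2) ^ m k y * R k ≤ 128 * dev k y := by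
        rw [pow_succ] at hflat
        linarith
      have h2 : ((1 / 2) ^ m k y) ^ 2 * R k ≤ 196608 * (dev k y ^ 2 / (12 * R k)) := by
        have e : 196608 * (dev k y ^ 2 / (12 * R k)) = (128 * dev k y) ^ 2 / R k := by
          field_simp
          ring
        rw [e, le_div_iff₀ hRk]
        calc ((1 / 2) ^ m k y) ^ 2 * R k * R k = ((1 / 2) ^ m k y * R k) ^ 2 := by ring
          _ ≤ (128 * dev k y) ^ 2 := by gcongr
      linarith
  have hflatsum : ∑ k ∈ Finset.range N, ∑ y ∈ Y k,
      (if F k y then ((1 / 2) ^ m k y) ^ 2 * R k else 0) ≤ 128 * E := by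
    refine (Finset.sum_le_sum fun k _ => (Finset.sum_filter (F k) _).ge).trans ?_
    refine hγ.sum_flat_le hR₀ N (fun k => (Y k).filter (F k)) m
      (fun k hk y hy y' hy' => hsep k hk y (Finset.mem_filter.1 hy).1 y' (Finset.mem_filter.1 hy').1)
      fun k hk y hy t ht hmesh => ?_
    obtain ⟨hy, hpos, hflat, ha, hb⟩ := Finset.mem_filter.1 hy
    have hRk := hR k
    obtain ⟨hsy, ha0, has, hsb, hbL, -, -, -⟩ := hsab k y hk hy
    obtain ⟨ha'0, ha'a, hbb', hb'L, haa', hbb2, -, hseg⟩ := hdev k hk y hy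
    obtain ⟨z, ⟨hzball, z₀, hz₀, rfl⟩, hzfar⟩ := exists_far_of_lt_jonesBeta hRk
      (by positivity) (hm k y hpos).1 (γ (a' k y)) (γ (b' k y))
    have h1 := dist_triangle_left (γ (a k y)) y (γ (a' k y))
    have h2 := dist_triangle_right (γ (b k y)) y (γ (b' k y))
    rw [mem_ball] at hzball
    rw [dist_comm y] at h2
    have := flat_gain hcont ha'0 (s₀ := s k y) ⟨ha'a.trans has, hsb.trans hbb'⟩ hb'L hz₀ hseg
      (c := (1 / 2) ^ (m k y + 1) * R k) (R := R k) (by positivity) hflat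
      (mul_le_of_le_one_left hRk.le (pow_le_one₀ (by norm_num) (by norm_num)))
      (by rw [hsy]; linarith) (by rw [hsy]; linarith) (by rw [hsy]; exact hzball) hzfar ht hmesh
    rwa [hsy] at this
  have hends : ∑ k ∈ Finset.range N, ∑ y ∈ Y k,
      ((if a k y = 0 then (if R k ≤ E then R k else 0) else 0) +
        (if b k y = L then (if R k ≤ E then R k else 0) else 0)) ≤ 4 * E := by
    have h1 : ∀ k ∈ Finset.range N, ∑ y ∈ Y k,
      ((if a k y = 0 then (if R k ≤ E then R k else 0) else 0) +
        (if b k y = L then (if R k ≤ E then R k else 0) else 0)) ≤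
        2 * (if R k ≤ E then R k else 0) := by
      intro k hk
      have hk := Finset.mem_range.1 hk
      have hRk := hR k
      have hite : 0 ≤ (if R k ≤ E then R k else 0) := by split_ifs <;> linarith
      have hclose : ∀ p, ∀ y ∈ Y k, ∀ y' ∈ Y k, dist p y ≤ 6 * R k → dist p y' ≤ 6 * R k →
          y = y' := by
        intro p y hy y' hy' h1 h2
        by_contra hne
        have h3 := hsepR k hk y hy y' hy' hne
        have h4 := dist_triangle_left y y' p
        linarith
      have hA := sum_ite_le_of_forall_eq (Y k) (fun y => a k y = 0) hite
        fun y hy y' hy' h h' => by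
          obtain ⟨-, -, has, hsb, -, hd, -⟩ := hsab k y hk hy
          obtain ⟨-, -, has', hsb', -, hd', -⟩ := hsab k y' hk hy'
          exact hclose (γ 0) y hy y' hy' (h ▸ hd _ ⟨le_rfl, has.trans hsb⟩)
            (h' ▸ hd' _ ⟨le_rfl, has'.trans hsb'⟩)
      have hB := sum_ite_le_of_forall_eq (Y k) (fun y => b k y = L) hite
        fun y hy y' hy' h h' => by
          obtain ⟨-, -, has, hsb, -, hd, -⟩ := hsab k y hk hy
          obtain ⟨-, -, has', hsb', -, hd', -⟩ := hsab k y' hk hy'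
          exact hclose (γ L) y hy y' hy' (h ▸ hd _ ⟨has.trans hsb, le_rfl⟩)
            (h' ▸ hd' _ ⟨has'.trans hsb', le_rfl⟩)
      rw [Finset.sum_add_distrib]
      linarith
    refine (Finset.sum_le_sum h1).trans ?_
    rw [← Finset.mul_sum]
    have h2 := sum_geometric_ite_le hE0 N R₀ hR₀.le
    have h3 := min_le_left E R₀
    linarith
  have htotal := Finset.sum_le_sum fun k hk =>
    Finset.sum_le_sum (hbound k (Finset.mem_range.1 hk))
  simp only [Finset.sum_add_distrib, ← Finset.mul_sum] at htotal hends
  linarith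

end SeparatedBalls

section Crowded

/-- A maximal separated subset of a finite set. -/
lemma exists_maximal_separated {H : Type*} [PseudoMetricSpace H] {d : ℝ} (hd : 0 ≤ d)
    (T : Finset H) :
    ∃ Y ⊆ T, (∀ y ∈ Y, ∀ y' ∈ Y, y ≠ y' → d < dist y y') ∧ ∀ x ∈ T, ∃ y ∈ Y, dist x y ≤ d := by
  classical
  induction T using Finset.induction_on with
  | empty => exact ⟨∅, by simp⟩
  | insert x T hx ih =>
    obtain ⟨Y, hYT, hsep, hcov⟩ := ih
    by_cases h : ∃ y ∈ Y, dist x y ≤ d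
    · refine ⟨Y, hYT.trans (Finset.subset_insert _ _), hsep, fun x' hx' => ?_⟩
      rcases Finset.mem_insert.1 hx' with rfl | hx'
      · exact h
      · exact hcov x' hx'
    · push Not at h
      refine ⟨insert x Y, Finset.insert_subset_insert x hYT, ?_, fun x' hx' => ?_⟩
      · intro y hy y' hy' hne
        rcases Finset.mem_insert.1 hy with rfl | hmem <;>
          rcases Finset.mem_insert.1 hy' with rfl | hmem'
        · exact absurd rfl hne
        · exact h y' hmem'
        · rw [dist_comm]
          exact h y hmem
        · exact hsep y hmem y' hmem' hne
      · rcases Finset.mem_insert.1 hx' with rfl | hx'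
        · exact ⟨x', Finset.mem_insert_self _ _, by simpa using hd⟩
        · obtain ⟨y, hy, hxy⟩ := hcov x' hx'
          exact ⟨y, Finset.mem_insert_of_mem hy, hxy⟩

/-- Greedy colouring of a finite graph of bounded degree. -/
lemma exists_coloring {α : Type*} (adj : α → α → Prop) (hsymm : ∀ x y, adj x y → adj y x) {n : ℕ}
    (T : Finset α) (P : Finset α) (hTP : T ⊆ P)
    (hdeg : ∀ x ∈ T, ∀ S ⊆ P, (∀ y ∈ S, adj x y) → S.card < n) :
    ∃ col : α → ℕ, (∀ x ∈ T, col x < n) ∧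
      ∀ x ∈ T, ∀ y ∈ T, x ≠ y → col x = col y → ¬ adj x y := by
  classical
  induction T using Finset.induction_on with
  | empty => exact ⟨fun _ => 0, by simp⟩
  | insert x T hx ih =>
    obtain ⟨col, hlt, hcol⟩ := ih ((Finset.subset_insert x T).trans hTP)
      fun y hy => hdeg y (Finset.mem_insert_of_mem hy)
    have hcard : ((T.filter (adj x)).image col).card < (Finset.range n).card := by
      rw [Finset.card_range]
      exact Finset.card_image_le.trans_lt (hdeg x (Finset.mem_insert_self x T) _
        ((Finset.filter_subset _ _).trans ((Finset.subset_insert x T).trans hTP))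
        fun y hy => (Finset.mem_filter.1 hy).2)
    obtain ⟨c, hc, hcn⟩ := Finset.exists_mem_notMem_of_card_lt_card hcard
    have hnew : ∀ y ∈ T, c = col y → ¬ adj x y := fun y hy h hadj =>
      hcn (Finset.mem_image.2 ⟨y, Finset.mem_filter.2 ⟨hy, hadj⟩, h.symm⟩)
    have hne : ∀ y ∈ T, y ≠ x := fun y hy h => hx (h ▸ hy)
    refine ⟨Function.update col x c, fun y hy => ?_, fun y hy z hz hyz => ?_⟩
    · rcases Finset.mem_insert.1 hy with rfl | hy
      · simpa using hc
      · rw [Function.update_of_ne (hne y hy)]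
        exact hlt y hy
    · rcases Finset.mem_insert.1 hy with rfl | hmem <;>
        rcases Finset.mem_insert.1 hz with rfl | hmem'
      · exact absurd rfl hyz
      · rw [Function.update_self, Function.update_of_ne (hne z hmem')]
        exact hnew z hmem'
      · rw [Function.update_self, Function.update_of_ne (hne y hmem)]
        exact fun h hadj => hnew y hmem h.symm (hsymm _ _ hadj)
      · rw [Function.update_of_ne (hne y hmem), Function.update_of_ne (hne z hmem')]
        exact hcol y hmem z hmem' hyz

/-- Pieces of a fine cover near separated points of a curve have large total diameter. -/
lemma card_mul_le_tsum_of_separated {H : Type*} [PseudoMetricSpace H] {γ : ℝ → H} {L : ℝ}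
    (hγ : ContinuousOn γ (Set.Icc 0 L)) {r : ℝ} (hr : 0 < r)
    (C : Finset H) (hC : ∀ x ∈ C, x ∈ γ '' Set.Icc 0 L)
    (hfar : ∀ x ∈ C, ∃ x' ∈ γ '' Set.Icc 0 L, r / 4 ≤ dist x' x)
    (hsep : ∀ x ∈ C, ∀ x' ∈ C, x ≠ x' → r < dist x x')
    {t : ℕ → Set H} (ht : γ '' Set.Icc 0 L ⊆ ⋃ n, t n)
    (hmesh : ∀ n, ediam (t n) ≤ ENNReal.ofReal (r / 4)) :
    ENNReal.ofReal (C.card * (r / 4)) ≤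
      ∑' n, {n | (t n ∩ ⋃ x ∈ C, γ '' Set.Icc 0 L ∩ closedBall x (r / 4)).Nonempty}.indicator
        (fun n => ediam (t n)) n := by
  classical
  have hdist : ∀ n, ∀ u ∈ t n, ∀ v ∈ t n, dist u v ≤ r / 4 := by
    intro n u hu v hv
    have := (edist_le_ediam_of_mem hu hv).trans (hmesh n)
    rwa [edist_dist, ENNReal.ofReal_le_ofReal_iff (by positivity)] at this
  set N : H → Set ℕ := fun x => {n | (t n ∩ (γ '' Set.Icc 0 L ∩ closedBall x (r / 4))).Nonempty}
    with hN
  have hone : ∀ x ∈ C, ENNReal.ofReal (r / 4) ≤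
      ∑' n, (N x).indicator (fun n => ediam (t n)) n := by
    intro x hx
    obtain ⟨s, hs, rfl⟩ := hC x hx
    obtain ⟨_, ⟨s', hs', rfl⟩, hfar⟩ := hfar _ hx
    have := ofReal_sub_le_tsum_of_curve hγ ht (LipschitzWith.dist_left (γ s)) (s₁ := s) (s₂ := s')
      hs hs' (p := 0) (q := r / 4) (N := N (γ s)) (by simp) hfar
      fun n s'' hs'' hn hmem => ⟨γ s'', hn, ⟨s'', Set.uIcc_subset_Icc hs hs' hs'', rfl⟩, hmem.2⟩
    simpa using this
  have hdisj : ∀ x ∈ C, ∀ x' ∈ C, ∀ n, n ∈ N x → n ∈ N x' → x = x' := by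
    rintro x hx x' hx' n ⟨u, hu, -, hux⟩ ⟨v, hv, -, hvx⟩
    by_contra hne
    have h1 := hsep x hx x' hx' hne
    have h2 := hdist n u hu v hv
    have h3 := dist_triangle4 x u v x'
    rw [mem_closedBall] at hvx
    rw [mem_closedBall'] at hux
    linarith
  calc ENNReal.ofReal (C.card * (r / 4)) = ∑ x ∈ C, ENNReal.ofReal (r / 4) := by
        rw [Finset.sum_const, nsmul_eq_mul, ENNReal.ofReal_mul (by positivity),
          ENNReal.ofReal_natCast]
    _ ≤ ∑ x ∈ C, ∑' n, (N x).indicator (fun n => ediam (t n)) n := Finset.sum_le_sum hone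
    _ = ∑' n, ∑ x ∈ C, (N x).indicator (fun n => ediam (t n)) n :=
        (Summable.tsum_finsetSum fun _ _ => ENNReal.summable).symm
    _ ≤ _ := by
        refine ENNReal.tsum_le_tsum fun n => ?_
        by_cases hn : ∃ x ∈ C, n ∈ N x
        · obtain ⟨x, hx, hnx⟩ := hn
          have hmem : n ∈
              {n | (t n ∩ ⋃ x ∈ C, γ '' Set.Icc 0 L ∩ closedBall x (r / 4)).Nonempty} := by
            obtain ⟨u, hu, hu'⟩ := hnx
            exact ⟨u, hu, Set.mem_biUnion hx hu'⟩
          rw [Set.indicator_of_mem hmem, Finset.sum_eq_single x]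
          · exact Set.indicator_le_self _ _ n
          · exact fun x' hx' hne =>
              Set.indicator_of_notMem (fun h => hne (hdisj x' hx' x hx n h hnx)) _
          · exact fun h => absurd hx h
        · push Not at hn
          rw [Finset.sum_eq_zero fun x hx => Set.indicator_of_notMem (hn x hx) _]
          exact zero_le

variable {H : Type*} [NormedAddCommGroup H] [InnerProductSpace ℝ H] {γ : ℝ → H} {L : ℝ}

/-- Points of a net with many neighbours force fine covers to be longer than coarse ones. -/
lemma IsArclengthParam.crowded_le (hγ : IsArclengthParam γ L) {r A : ℝ} (hr : 0 < r) (hA : 1 < A)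
    {n : ℕ} (hn : 776 * A ≤ n) (hn2 : 2 ≤ n) (F T : Finset H)
    (hF : ∀ x ∈ F, x ∈ γ '' Set.Icc 0 L)
    (hsep : ∀ x ∈ F, ∀ x' ∈ F, x ≠ x' → r < dist x x') (hTF : T ⊆ F)
    (hT : ∀ x ∈ T, ∃ S ⊆ F, (∀ y ∈ S, dist x y ≤ 24 * (A * r)) ∧ n ≤ S.card) :
    coverLengthReal (γ '' Set.Icc 0 L) (97 * (A * r)) + T.card * (r / 8) ≤
      coverLengthReal (γ '' Set.Icc 0 L) (r / 4) := by
  classical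
  have hAr : r < A * r := lt_mul_of_one_lt_left hr hA
  rcases T.eq_empty_or_nonempty with rfl | hTne
  · simpa using hγ.coverLengthReal_anti (by positivity) (by linarith)
  obtain ⟨Y, hYT, hYsep, hYcov⟩ := exists_maximal_separated (d := 48 * (A * r)) (by positivity) T
  have hYne : Y.Nonempty := by
    obtain ⟨x, hx⟩ := hTne
    obtain ⟨y, hy, -⟩ := hYcov x hx
    exact ⟨y, hy⟩
  have hproj : ∀ x, ∃ y ∈ Y, ∀ y' ∈ Y, dist x y ≤ dist x y' := fun x =>
    Finset.exists_min_image Y (dist x) hYne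
  choose π hπY hπ using hproj
  set C : H → Finset H := fun y => F.filter fun x => π x = y ∧ dist x y ≤ 48 * (A * r) with hCdef
  have hCF : ∀ y, C y ⊆ F := fun y => Finset.filter_subset _ _
  have hCcard : ∀ y ∈ Y, n ≤ (C y).card := by
    intro y hy
    obtain ⟨S, hSF, hS, hn⟩ := hT y (hYT hy)
    refine hn.trans (Finset.card_le_card fun x hx => Finset.mem_filter.2 ⟨hSF hx, ?_, ?_⟩)
    · by_contra hne
      have h1 := hYsep (π x) (hπY x) y hy hne
      have h2 := hπ x y hy
      have h3 := hS x hx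
      have h4 := dist_triangle_left (π x) y x
      rw [dist_comm y] at h3
      linarith
    · have h3 := hS x hx
      rw [dist_comm]
      linarith
  have hgain : ∀ y ∈ Y, 97 * (A * r) + (C y).card * (r / 8) ≤ (C y).card * (r / 4) := by
    intro y hy
    have h1 : (n : ℝ) ≤ (C y).card := by exact_mod_cast hCcard y hy
    nlinarith
  have hTcard : (T.card : ℝ) * (r / 8) ≤ ∑ y ∈ Y, (C y).card * (r / 8) := by
    rw [← Finset.sum_mul]
    gcongr
    have h1 : T ⊆ Y.biUnion C := by
      intro x hx
      obtain ⟨y, hy, hxy⟩ := hYcov x hx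
      exact Finset.mem_biUnion.2 ⟨π x, hπY x, Finset.mem_filter.2 ⟨hTF hx, rfl, (hπ x y hy).trans hxy⟩⟩
    exact_mod_cast (Finset.card_le_card h1).trans Finset.card_biUnion_le
  have hmerge := hγ.coverLengthReal_add_le (δ := 97 * (A * r)) (δ' := r / 4) (by positivity)
    (by linarith) Y (fun y => ⋃ x ∈ C y, γ '' Set.Icc 0 L ∩ closedBall x (r / 4))
    (fun _ => 97 * (A * r)) (fun y => (C y).card * (r / 8)) (fun _ _ => by positivity)
    ?_ ?_ (fun _ _ => le_rfl) ?_
  · linarith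
  · intro y _ y' _ hne u hu v hv
    obtain ⟨x, hx, -, hux⟩ := Set.mem_iUnion₂.1 hu
    obtain ⟨x', hx', -, hvx⟩ := Set.mem_iUnion₂.1 hv
    obtain ⟨hxF, hπx, -⟩ := Finset.mem_filter.1 hx
    obtain ⟨hxF', hπx', -⟩ := Finset.mem_filter.1 hx'
    have h1 := hsep x hxF x' hxF' fun h => hne (hπx.symm.trans (h ▸ hπx'))
    have h2 := dist_triangle4 x u v x'
    rw [mem_closedBall'] at hux
    rw [mem_closedBall] at hvx
    linarith
  · intro y _ u hu v hv
    obtain ⟨x, hx, -, hux⟩ := Set.mem_iUnion₂.1 hu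
    obtain ⟨x', hx', -, hvx⟩ := Set.mem_iUnion₂.1 hv
    obtain ⟨-, -, hxy⟩ := Finset.mem_filter.1 hx
    obtain ⟨-, -, hxy'⟩ := Finset.mem_filter.1 hx'
    have h2 := dist_triangle4 u x x' v
    have h3 := dist_triangle_right x x' y
    rw [mem_closedBall] at hux
    rw [mem_closedBall'] at hvx
    linarith
  · intro y hy t ht hmesh
    rw [← ENNReal.ofReal_add (by positivity) (by positivity)]
    refine (ENNReal.ofReal_le_ofReal (hgain y hy)).trans
      (card_mul_le_tsum_of_separated hγ.lip.continuousOn hr (C y) (fun x hx => hF x (hCF y hx)) ?_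
        (fun x hx x' hx' => hsep x (hCF y hx) x' (hCF y hx')) ht hmesh)
    intro x hx
    obtain ⟨x', hx', hne⟩ := Finset.exists_mem_ne (hn2.trans (hCcard y hy)) x
    exact ⟨x', hF x' (hCF y hx'), by linarith [hsep x' (hCF y hx') x (hCF y hx) hne]⟩

end Crowded

section Nets

variable {H : Type*} [NormedAddCommGroup H] [InnerProductSpace ℝ H] {γ : ℝ → H} {L : ℝ}

lemma sum_range_three_mul (f : ℕ → ℝ) (N : ℕ) :
    ∑ i ∈ Finset.range (3 * N), f i =
      ∑ j ∈ Finset.range 3, ∑ k ∈ Finset.range N, f (3 * k + j) := by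
  rw [Finset.sum_comm]
  induction N with
  | zero => simp
  | succ N ih =>
    rw [Finset.sum_range_succ, ← ih, mul_add, mul_one, Finset.sum_range_add]

/-- The points of a sequence of nets with many neighbours carry little total scale. -/
lemma IsArclengthParam.sum_crowded_le (hγ : IsArclengthParam γ L) {r A : ℝ} (hr : 0 < r)
    (hA : 1 < A) {n q : ℕ} (hn : 776 * A ≤ n) (hn2 : 2 ≤ n) (hq : 388 * A ≤ 2 ^ q) (N : ℕ)
    (F T : ℕ → Finset H) (hF : ∀ i, ∀ x ∈ F i, x ∈ γ '' Set.Icc 0 L)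
    (hsep : ∀ i, ∀ x ∈ F i, ∀ x' ∈ F i, x ≠ x' → r / 2 ^ i < dist x x') (hTF : ∀ i, T i ⊆ F i)
    (hT : ∀ i, ∀ x ∈ T i, ∃ S ⊆ F i, (∀ y ∈ S, dist x y ≤ 24 * (A * (r / 2 ^ i))) ∧ n ≤ S.card) :
    ∑ i ∈ Finset.range N, (T i).card * (r / 2 ^ i) ≤ 8 * q * (L - dist (γ L) (γ 0)) := by
  set G : ℕ → ℝ := fun i => coverLengthReal (γ '' Set.Icc 0 L) (97 * (A * (r / 2 ^ i))) with hG
  have hpos : ∀ i : ℕ, 0 < 97 * (A * (r / 2 ^ i)) := fun i => by positivity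
  have h1 : ∀ i, (T i).card * (r / 2 ^ i) ≤ 8 * (G (i + q) - G i) := by
    intro i
    have h2 := hγ.crowded_le (r := r / 2 ^ i) (by positivity) hA hn hn2 (F i) (T i) (hF i) (hsep i)
      (hTF i) (hT i)
    have h3 : coverLengthReal (γ '' Set.Icc 0 L) (r / 2 ^ i / 4) ≤ G (i + q) := by
      refine hγ.coverLengthReal_anti (hpos _) ?_
      have e : 97 * (A * (r / 2 ^ (i + q))) = (388 * A / 2 ^ q) * (r / 2 ^ i / 4) := by
        rw [pow_add]
        field_simp
        ring
      rw [e]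
      exact mul_le_of_le_one_left (by positivity) ((div_le_one (by positivity)).2 hq)
    linarith
  refine (Finset.sum_le_sum fun i _ => h1 i).trans ?_
  rw [← Finset.mul_sum]
  have := sum_range_sub_add_le (G := G) (fun i => hγ.le_coverLengthReal (hpos i))
    (fun i => hγ.coverLengthReal_le (hpos i)) N q
  linarith

/-- The beta sum over the points of a sequence of nets with few neighbours. -/
lemma IsArclengthParam.sum_sparse_le (hγ : IsArclengthParam γ L) {r A : ℝ} (hr : 0 < r)
    (hA : 1 < A) {n : ℕ} (N : ℕ) (F T : ℕ → Finset H) (hF : ∀ i, ∀ x ∈ F i, x ∈ γ '' Set.Icc 0 L)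
    (hTF : ∀ i, T i ⊆ F i)
    (hT : ∀ i, ∀ x ∈ T i, ∀ S ⊆ F i, (∀ y ∈ S, dist x y ≤ 24 * (A * (r / 2 ^ i))) → S.card < n) :
    ∑ i ∈ Finset.range (3 * N), ∑ x ∈ T i,
        jonesBeta (γ '' Set.Icc 0 L) (ball x (A * (r / 2 ^ i))) ^ 2 * (A * (r / 2 ^ i)) ≤
      9000000 * n * (L - dist (γ L) (γ 0)) := by
  classical
  have hcol := fun i => exists_coloring (fun x y => dist x y ≤ 24 * (A * (r / 2 ^ i)))
    (fun x y h => by rwa [dist_comm]) (n := n) (T i) (F i) (hTF i) (hT i)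
  choose col hcoln hcol using hcol
  set E := L - dist (γ L) (γ 0) with hE
  set f : ℕ → H → ℝ := fun i x =>
    jonesBeta (γ '' Set.Icc 0 L) (ball x (A * (r / 2 ^ i))) ^ 2 * (A * (r / 2 ^ i)) with hf
  have hclass : ∀ j c, ∑ k ∈ Finset.range N, ∑ x ∈ T (3 * k + j) with col (3 * k + j) x = c,
      f (3 * k + j) x ≤ 3000000 * E := by
    intro j c
    have e : ∀ k, A * (r / 2 ^ (3 * k + j)) = A * (r / 2 ^ j) / 8 ^ k := by
      intro k
      rw [pow_add, pow_mul]
      norm_num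
      field_simp
    have h := hγ.sum_jonesBeta_sq_le (R₀ := A * (r / 2 ^ j)) (by positivity) N
      (fun k => (T (3 * k + j)).filter fun x => col (3 * k + j) x = c)
      (fun k _ y hy => hF _ y (hTF _ (Finset.mem_filter.1 hy).1))
      (fun k _ y hy y' hy' hne => by
        obtain ⟨hy, hyc⟩ := Finset.mem_filter.1 hy
        obtain ⟨hy', hyc'⟩ := Finset.mem_filter.1 hy'
        rw [← e]
        exact not_le.1 (hcol _ y hy y' hy' hne (hyc.trans hyc'.symm)))
    simpa only [hf, e] using h
  calc ∑ i ∈ Finset.range (3 * N), ∑ x ∈ T i, f i x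
      = ∑ i ∈ Finset.range (3 * N), ∑ c ∈ Finset.range n, ∑ x ∈ T i with col i x = c, f i x :=
        Finset.sum_congr rfl fun i _ => (Finset.sum_fiberwise_of_maps_to
          (fun x hx => Finset.mem_range.2 (hcoln i x hx)) _).symm
    _ = ∑ c ∈ Finset.range n, ∑ j ∈ Finset.range 3, ∑ k ∈ Finset.range N,
          ∑ x ∈ T (3 * k + j) with col (3 * k + j) x = c, f (3 * k + j) x := by
        rw [Finset.sum_comm]
        exact Finset.sum_congr rfl fun c _ => sum_range_three_mul _ N
    _ ≤ ∑ c ∈ Finset.range n, ∑ j ∈ Finset.range 3, 3000000 * E :=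
        Finset.sum_le_sum fun c _ => Finset.sum_le_sum fun j _ => hclass j c
    _ = 9000000 * n * E := by
        simp only [Finset.sum_const, Finset.card_range, nsmul_eq_mul]
        push_cast
        ring

/-- The beta sum over a finite sequence of finite nets. -/
theorem IsArclengthParam.sum_jonesBeta_sq_le_of_nets (hγ : IsArclengthParam γ L) {r A : ℝ}
    (hr : 0 < r) (hA : 1 < A) {n q : ℕ} (hn : 776 * A ≤ n) (hn2 : 2 ≤ n) (hq : 388 * A ≤ 2 ^ q)
    (N : ℕ) (F : ℕ → Finset H) (hF : ∀ i, ∀ x ∈ F i, x ∈ γ '' Set.Icc 0 L)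
    (hsep : ∀ i, ∀ x ∈ F i, ∀ x' ∈ F i, x ≠ x' → r / 2 ^ i < dist x x') :
    ∑ i ∈ Finset.range (3 * N), ∑ x ∈ F i,
        jonesBeta (γ '' Set.Icc 0 L) (ball x (A * (r / 2 ^ i))) ^ 2 * (A * (r / 2 ^ i)) ≤
      (9000000 * n + 8 * A * q) * (L - dist (γ L) (γ 0)) := by
  classical
  set f : ℕ → H → ℝ := fun i x =>
    jonesBeta (γ '' Set.Icc 0 L) (ball x (A * (r / 2 ^ i))) ^ 2 * (A * (r / 2 ^ i)) with hf
  set P : ℕ → H → Prop := fun i x =>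
    ∃ S ⊆ F i, (∀ y ∈ S, dist x y ≤ 24 * (A * (r / 2 ^ i))) ∧ n ≤ S.card with hP
  have h1 := hγ.sum_crowded_le hr hA hn hn2 hq (3 * N) F (fun i => (F i).filter (P i)) hF hsep
    (fun i => Finset.filter_subset _ _) fun i x hx => (Finset.mem_filter.1 hx).2
  have h2 := hγ.sum_sparse_le hr hA (n := n) N F (fun i => (F i).filter fun x => ¬ P i x) hF
    (fun i => Finset.filter_subset _ _) fun i x hx S hS hdist =>
      not_le.1 fun hle => (Finset.mem_filter.1 hx).2 ⟨S, hS, hdist, hle⟩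
  have h3 : ∀ i, ∑ x ∈ F i with P i x, f i x ≤ A * (((F i).filter (P i)).card * (r / 2 ^ i)) := by
    intro i
    have hR : 0 < A * (r / 2 ^ i) := by positivity
    calc ∑ x ∈ F i with P i x, f i x ≤ ∑ x ∈ F i with P i x, A * (r / 2 ^ i) :=
          Finset.sum_le_sum fun x _ => mul_le_of_le_one_left hR.le
            (pow_le_one₀ (jonesBeta_nonneg _ _) (jonesBeta_ball_le_one _ x hR))
      _ = _ := by
          rw [Finset.sum_const, nsmul_eq_mul]
          ring
  have h4 : ∑ i ∈ Finset.range (3 * N), ∑ x ∈ F i, f i x =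
      ∑ i ∈ Finset.range (3 * N), ∑ x ∈ F i with P i x, f i x +
        ∑ i ∈ Finset.range (3 * N), ∑ x ∈ F i with ¬ P i x, f i x := by
    rw [← Finset.sum_add_distrib]
    exact Finset.sum_congr rfl fun i _ => (Finset.sum_filter_add_sum_filter_not _ _ _).symm
  have h5 := Finset.sum_le_sum fun i (_ : i ∈ Finset.range (3 * N)) => h3 i
  rw [← Finset.mul_sum] at h5
  have h6 := mul_le_mul_of_nonneg_left h1 (zero_le_one.trans hA.le)
  rw [h4]
  calc _ ≤ A * (8 * q * (L - dist (γ L) (γ 0))) + 9000000 * n * (L - dist (γ L) (γ 0)) :=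
        add_le_add (h5.trans h6) h2
    _ = _ := by ring

end Nets

/-- The beta sum bound with an explicit constant. -/
lemma IsArclengthParam.betaSum_le {H : Type*} [NormedAddCommGroup H] [InnerProductSpace ℝ H]
    {γ : ℝ → H} {L : ℝ} (hγ : IsArclengthParam γ L) {A : ℝ} (hA : 1 < A) {n q : ℕ}
    (hn : 776 * A ≤ n) (hn2 : 2 ≤ n) (hq : 388 * A ≤ 2 ^ q) {n₀ : ℤ} {X : ℤ → Set H}
    (hX : IsMultiresolution (γ '' Set.Icc 0 L) n₀ X) :
    betaSum (γ '' Set.Icc 0 L) A n₀ X ≤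
      ENNReal.ofReal (2 * (9000000 * n + 8 * A * q) * (L - dist (γ L) (γ 0))) := by
  classical
  rw [betaSum, ← ENNReal.tsum_sigma, ENNReal.tsum_eq_iSup_sum]
  refine iSup_le fun s => ?_
  set Γ := γ '' Set.Icc 0 L
  set r : ℝ := (2 : ℝ) ^ (-n₀) with hr_def
  have hr : 0 < r := by positivity
  have hscale : ∀ i : ℕ, r / 2 ^ i = (2 : ℝ) ^ (-(n₀ + i)) := fun i => by
    rw [neg_add, zpow_add₀ two_ne_zero, zpow_neg 2 (i : ℤ), zpow_natCast, div_eq_mul_inv]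
  let f : (Σ m : {m : ℤ // n₀ ≤ m}, X m.1) → ℕ × H := fun p => ((p.1.1 - n₀).toNat, (p.2 : H))
  have hlevel : ∀ p : (Σ m : {m : ℤ // n₀ ≤ m}, X m.1), n₀ + ((f p).1 : ℤ) = p.1.1 := fun p => by
    have := p.1.2
    simp only [f]
    omega
  have hf : Function.Injective f := by
    rintro ⟨⟨m, hm⟩, x, hx⟩ ⟨⟨m', hm'⟩, x', hx'⟩ h
    have h1 := hlevel ⟨⟨m, hm⟩, x, hx⟩
    have h2 := hlevel ⟨⟨m', hm'⟩, x', hx'⟩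
    rw [h] at h1
    obtain rfl : m = m' := h1.symm.trans h2
    obtain rfl : x = x' := congrArg Prod.snd h
    rfl
  let T := s.image f
  let F : ℕ → Finset H := fun i => (T.filter (·.1 = i)).image Prod.snd
  have hFT : ∀ i x, x ∈ F i ↔ (i, x) ∈ T := fun i x => by
    simp only [F, Finset.mem_image, Finset.mem_filter]
    constructor
    · rintro ⟨⟨j, y⟩, ⟨h, rfl⟩, rfl⟩
      exact h
    · exact fun h => ⟨(i, x), ⟨h, rfl⟩, rfl⟩
  have hFX : ∀ i, ∀ x ∈ F i, x ∈ X (n₀ + i) := fun i x hx => by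
    obtain ⟨p, -, hp⟩ := Finset.mem_image.1 ((hFT i x).1 hx)
    have h := hlevel p
    rw [hp] at h
    have hx' : (p.2 : H) = x := congrArg Prod.snd hp
    simp only at h
    rw [h, ← hx']
    exact p.2.2
  set N := T.sup Prod.fst + 1
  have key := hγ.sum_jonesBeta_sq_le_of_nets hr hA hn hn2 hq N F
    (fun i x hx => hX.subset_arc _ (by omega) (hFX i x hx))
    (fun i x hx x' hx' hne => by
      rw [hscale]
      exact hX.separated _ (by omega) x (hFX i x hx) x' (hFX i x' hx') hne)
  rw [← Finset.sum_finset_product' T (Finset.range (3 * N)) F (fun p => ?_)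
    (f := fun i x => jonesBeta Γ (ball x (A * (r / 2 ^ i))) ^ 2 * (A * (r / 2 ^ i))),
    Finset.sum_image hf.injOn] at key
  · rw [← ENNReal.ofReal_sum_of_nonneg fun p _ => by positivity]
    refine ENNReal.ofReal_le_ofReal ?_
    rw [mul_assoc]
    refine le_of_eq_of_le ?_ (mul_le_mul_of_nonneg_left key zero_le_two)
    rw [Finset.mul_sum]
    refine Finset.sum_congr rfl fun p _ => ?_
    rw [hscale, hlevel]
    simp only [f]
    ring
  · refine ⟨fun hp => ⟨?_, (hFT _ _).2 hp⟩, fun hp => (hFT _ _).1 hp.2⟩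
    have := Finset.le_sup (f := Prod.fst) hp
    rw [Finset.mem_range]
    omega

/-- Theorem A: for every `A > 1` there is `C > 0`, depending only on `A`, such that
for every real Hilbert space `H`, rectifiable Jordan arc `Γ ⊆ H`, and multiresolution
family for `Γ` with inflation factor `A`,
`Σ_{Q ∈ Ĝ} β(Q)² diam(Q) ≤ C·(ℓ(Γ) − crd(Γ))`. -/
theorem statement1 (A : ℝ) (hA : 1 < A) :
    ∃ C : ℝ, 0 < C ∧
      ∀ (H : Type) [NormedAddCommGroup H] [InnerProductSpace ℝ H] [CompleteSpace H]
        (γ : ℝ → H) (L : ℝ) (n₀ : ℤ) (X : ℤ → Set H),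
        IsArclengthParam γ L →
        IsMultiresolution (γ '' Set.Icc 0 L) n₀ X →
        betaSum (γ '' Set.Icc 0 L) A n₀ X
          ≤ ENNReal.ofReal (C * (L - dist (γ L) (γ 0))) := by
  obtain ⟨q, hq⟩ := pow_unbounded_of_one_lt (388 * A) (one_lt_two (α := ℝ))
  have hn : 776 * A ≤ ((⌈776 * A⌉₊ + 2 : ℕ) : ℝ) := by
    push_cast
    linarith [Nat.le_ceil (776 * A)]
  refine ⟨2 * (9000000 * (⌈776 * A⌉₊ + 2 : ℕ) + 8 * A * q), ?_, ?_⟩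
  · have h : 0 < A := zero_lt_one.trans hA
    positivity
  · intro H _ _ _ γ L n₀ X hγ hX
    exact hγ.betaSum_le hA hn (Nat.le_add_left _ _) hq.le hX
end

section
/- (Lemma 3.1) For every c₀ > 0 there exists a positive integer J such that the following holds in any real Hilbert space H: let τ : [c, d] → H be continuous, let [a, b] ⊆ [c, d], and let τ′ = τ|_{[a,b]} be nonconstant. Assume τ([c, a]) is contained in the closed ball of radius 4·2^{-J}·diam(τ′) around τ(a), and τ([b, d]) is contained in the closed ball of radius 4·2^{-J}·diam(τ′) around τ(b). If β̃(τ′) ≥ c₀, then β̃(τ) ≥ (1/4)·β̃(τ′). -/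
open Metric

/-- `β̃` of the restriction of `τ` to `[a, b]`: the sup over `t ∈ [a, b]` of the
distance from `τ(t)` to the segment joining the endpoint values, divided by the
diameter of the image. -/
noncomputable def tildeBeta {H : Type*} [NormedAddCommGroup H] [InnerProductSpace ℝ H]
    (τ : ℝ → H) (a b : ℝ) : ℝ :=
  sSup ((fun t => Metric.infDist (τ t) (segment ℝ (τ a) (τ b))) '' Set.Icc a b)
    / Metric.diam (τ '' Set.Icc a b)

lemma infDist_segment_le_infDist_segment_add {H : Type*} [SeminormedAddCommGroup H]
    [NormedSpace ℝ H] {a b c d : H} {ε : ℝ} (hac : dist c a ≤ ε) (hbd : dist d b ≤ ε) (x : H) :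
    infDist x (segment ℝ a b) ≤ infDist x (segment ℝ c d) + ε := by
  rw [← sub_le_iff_le_add, le_infDist ⟨c, left_mem_segment ℝ c d⟩]
  rintro y ⟨u, v, hu, hv, huv, rfl⟩
  have hx : infDist x (segment ℝ a b) ≤ dist x (u • a + v • b) :=
    infDist_le_dist_of_mem ⟨u, v, hu, hv, huv, rfl⟩
  have hd : dist (u • c + v • d) (u • a + v • b) ≤ ε :=
    calc dist (u • c + v • d) (u • a + v • b)
        ≤ dist (u • c) (u • a) + dist (v • d) (v • b) := dist_add_add_le _ _ _ _
      _ = u * dist c a + v * dist d b := by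
        rw [dist_smul₀, dist_smul₀, Real.norm_of_nonneg hu, Real.norm_of_nonneg hv]
      _ ≤ u * ε + v * ε := by gcongr
      _ = ε := by rw [← add_mul, huv, one_mul]
  linarith [dist_triangle x (u • c + v • d) (u • a + v • b)]

lemma diam_le_diam_add_of_forall_exists_dist_le {X : Type*} [PseudoMetricSpace X] {s t : Set X}
    {ε : ℝ} (hε : 0 ≤ ε) (ht : Bornology.IsBounded t) (h : ∀ x ∈ s, ∃ y ∈ t, dist x y ≤ ε) :
    diam s ≤ diam t + 2 * ε := by
  refine diam_le_of_forall_dist_le (by positivity) fun x hx y hy => ?_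
  obtain ⟨x', hx', hxx'⟩ := h x hx
  obtain ⟨y', hy', hyy'⟩ := h y hy
  have := dist_triangle4_right x y x' y'
  linarith [dist_le_diam_of_mem ht hx' hy']

/-- Lemma 3.1: for every `c₀ > 0` there exists a positive integer `J` such that in any
real Hilbert space, if `τ : [c,d] → H` is continuous, `[a,b] ⊆ [c,d]`, `τ′ = τ|_{[a,b]}`
is nonconstant, `τ([c,a])` and `τ([b,d])` lie in closed balls of radius
`4·2^{-J}·diam(τ′)` around `τ(a)` resp. `τ(b)`, and `β̃(τ′) ≥ c₀`, then
`β̃(τ) ≥ (1/4)·β̃(τ′)`. -/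
theorem statement6 (c₀ : ℝ) (hc₀ : 0 < c₀) :
    ∃ J : ℕ, 0 < J ∧
      ∀ (H : Type) [NormedAddCommGroup H] [InnerProductSpace ℝ H] [CompleteSpace H]
        (τ : ℝ → H) (c d a b : ℝ),
        c ≤ a → a ≤ b → b ≤ d →
        ContinuousOn τ (Set.Icc c d) →
        (∃ s ∈ Set.Icc a b, ∃ t ∈ Set.Icc a b, τ s ≠ τ t) →
        τ '' Set.Icc c a ⊆
          Metric.closedBall (τ a) (4 * (2:ℝ)^(-(J:ℤ)) * Metric.diam (τ '' Set.Icc a b)) →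
        τ '' Set.Icc b d ⊆
          Metric.closedBall (τ b) (4 * (2:ℝ)^(-(J:ℤ)) * Metric.diam (τ '' Set.Icc a b)) →
        c₀ ≤ tildeBeta τ a b →
        (1/4) * tildeBeta τ a b ≤ tildeBeta τ c d := by
  obtain ⟨n, hn⟩ := exists_pow_lt_of_lt_one
    (show 0 < min (1 / 2) (c₀ / 2) / 4 by positivity) (show (1 / 2 : ℝ) < 1 by norm_num)
  refine ⟨n + 1, n.succ_pos, ?_⟩
  intro H _ _ _ τ c d a b hca hab hbd hτ _ hτa hτb hβ
  have hδ : 4 * (2 : ℝ) ^ (-((n + 1 : ℕ) : ℤ)) ≤ min (1 / 2) (c₀ / 2) := by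
    have hpow : (2 : ℝ) ^ (-((n + 1 : ℕ) : ℤ)) = (1 / 2) ^ n / 2 := by
      rw [zpow_neg, zpow_natCast, pow_succ, one_div, inv_pow, mul_inv, div_eq_mul_inv]
    have : (0 : ℝ) < (1 / 2) ^ n := by positivity
    linarith
  have hδ₀ : 0 ≤ 4 * (2 : ℝ) ^ (-((n + 1 : ℕ) : ℤ)) := by positivity
  generalize 4 * (2 : ℝ) ^ (-((n + 1 : ℕ) : ℤ)) = δ at *
  have hsub : Set.Icc a b ⊆ Set.Icc c d := Set.Icc_subset_Icc hca hbd
  have hbdd : Bornology.IsBounded (τ '' Set.Icc c d) :=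
    (isCompact_Icc.image_of_continuousOn hτ).isBounded
  have hbdd' := hbdd.subset (Set.image_mono hsub)
  have hdiam_mono := diam_mono (Set.image_mono (f := τ) hsub) hbdd
  unfold tildeBeta at hβ ⊢
  set D := diam (τ '' Set.Icc a b)
  set E := diam (τ '' Set.Icc c d)
  set S' := sSup ((fun t => infDist (τ t) (segment ℝ (τ a) (τ b))) '' Set.Icc a b)
  set S := sSup ((fun t => infDist (τ t) (segment ℝ (τ c) (τ d))) '' Set.Icc c d)
  have hD : 0 < D := by
    refine diam_nonneg.lt_of_ne fun h => ?_
    rw [show D = 0 from h.symm, div_zero] at hβ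
    linarith
  have hE : E ≤ D + 2 * (δ * D) := by
    refine diam_le_diam_add_of_forall_exists_dist_le (by positivity) hbdd' ?_
    rintro _ ⟨t, ht, rfl⟩
    rcases le_total t a with hta | hta
    · exact ⟨τ a, ⟨a, ⟨le_rfl, hab⟩, rfl⟩, hτa ⟨t, ⟨ht.1, hta⟩, rfl⟩⟩
    rcases le_total b t with hbt | hbt
    · exact ⟨τ b, ⟨b, ⟨hab, le_rfl⟩, rfl⟩, hτb ⟨t, ⟨hbt, ht.2⟩, rfl⟩⟩
    · exact ⟨τ t, ⟨t, ⟨hta, hbt⟩, rfl⟩, by rw [dist_self]; positivity⟩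
  have hbddAbove : BddAbove ((fun t => infDist (τ t) (segment ℝ (τ c) (τ d))) '' Set.Icc c d) :=
    (isCompact_Icc.image_of_continuousOn
      ((continuous_infDist_pt _).comp_continuousOn hτ)).bddAbove
  have hS : S' ≤ S + δ * D := by
    refine csSup_le ((Set.nonempty_Icc.2 hab).image _) ?_
    rintro _ ⟨t, ht, rfl⟩
    have hle : infDist (τ t) (segment ℝ (τ c) (τ d)) ≤ S :=
      le_csSup hbddAbove ⟨t, hsub ht, rfl⟩
    have hseg := infDist_segment_le_infDist_segment_add
      (hτa ⟨c, ⟨le_rfl, hca⟩, rfl⟩) (hτb ⟨d, ⟨hbd, le_rfl⟩, rfl⟩) (τ t)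
    exact hseg.trans (by gcongr)
  rw [le_div_iff₀ hD] at hβ
  have hδD : δ * D ≤ 1 / 2 * D := by gcongr; exact hδ.trans (min_le_left _ _)
  have hδc : δ * D ≤ c₀ / 2 * D := by gcongr; exact hδ.trans (min_le_right _ _)
  have hE₀ : 0 < E := hD.trans_le hdiam_mono
  have hS' : 0 ≤ S' := (mul_pos hc₀ hD).le.trans hβ
  calc 1 / 4 * (S' / D) = (S' / 2) / (2 * D) := by ring
    _ ≤ (S' / 2) / E := by gcongr; linarith
    _ ≤ S / E := by gcongr; linarith
end

section
/- (Covering claim in the proof of Lemma 4.16) Let g : ℝ → ℝ be a measurable function with 0 ≤ g(t) ≤ 2 for all t, and let ν be the measure ν(S) = ∫_S g dλ. Let {I_i}_{i ∈ 𝒜} be a (possibly uncountable) family of nondegenerate closed intervals in ℝ such that ν(I_i) ≥ (1/2)·λ(I_i) for every i ∈ 𝒜. Then ν(⋃_{i ∈ 𝒜} I_i) ≥ (1/4)·λ(⋃_{i ∈ 𝒜} I_i). (The union of a family of nondegenerate intervals is Lebesgue measurable.) -/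
open MeasureTheory
open scoped ENNReal

open Set in
/-- A union of nondegenerate closed intervals exceeds the union of their interiors by a countable
set only. -/
theorem countable_iUnion_Icc_diff_iUnion_Ioo {ι : Type*} (a b : ι → ℝ) (hab : ∀ i, a i < b i) :
    ((⋃ i, Icc (a i) (b i)) \ ⋃ i, Ioo (a i) (b i)).Countable := by
  cases isEmpty_or_nonempty ι
  · simp
  set V := ⋃ i, Ioo (a i) (b i)
  have hmem : ∀ {x i}, x ∉ V → a i < x → b i ≤ x := fun {x i} hx h =>
    not_lt.1 fun h' => hx (mem_iUnion.2 ⟨i, h, h'⟩)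
  have hleft : {x | x ∉ V ∧ ∃ i, a i = x}.Countable := by
    choose! f hf using fun x (h : x ∈ {x | x ∉ V ∧ ∃ i, a i = x}) => h.2
    refine PairwiseDisjoint.countable_of_isOpen (s := fun x => Ioo (a (f x)) (b (f x))) ?_
      (fun _ _ => isOpen_Ioo) (fun x _ => nonempty_Ioo.2 (hab _))
    intro x hx y hy hxy
    refine disjoint_left.2 fun z hzx hzy => ?_
    have h1 := hf x hx
    have h2 := hf y hy
    rcases lt_or_gt_of_ne hxy with h | h
    · linarith [hmem (i := f x) hy.1 (by linarith), hzx.2, hzy.1]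
    · linarith [hmem (i := f y) hx.1 (by linarith), hzy.2, hzx.1]
  have hright : {x | x ∉ V ∧ ∃ i, b i = x}.Countable := by
    choose! f hf using fun x (h : x ∈ {x | x ∉ V ∧ ∃ i, b i = x}) => h.2
    refine PairwiseDisjoint.countable_of_isOpen (s := fun x => Ioo (a (f x)) (b (f x))) ?_
      (fun _ _ => isOpen_Ioo) (fun x _ => nonempty_Ioo.2 (hab _))
    intro x hx y hy hxy
    refine disjoint_left.2 fun z hzx hzy => ?_
    have h1 := hf x hx
    have h2 := hf y hy
    rcases lt_or_gt_of_ne hxy with h | h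
    · linarith [hmem (i := f y) hx.1 (by linarith [hzy.1, hzx.2]), hzx.2, hzy.1]
    · linarith [hmem (i := f x) hy.1 (by linarith [hzx.1, hzy.2]), hzy.2, hzx.1]
  refine (hleft.union hright).mono ?_
  rintro x ⟨hxU, hxV⟩
  obtain ⟨i, hi⟩ := mem_iUnion.1 hxU
  rcases hi.1.eq_or_lt with h | h
  · exact Or.inl ⟨hxV, i, h⟩
  · exact Or.inr ⟨hxV, i, (hmem hxV h).antisymm hi.2⟩

open Set in
/-- Among three or more intervals with a common point, one is covered by the others. -/
theorem exists_Icc_subset_biUnion_erase {ι : Type*} [DecidableEq ι] (a b : ι → ℝ) {G : Finset ι}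
    (hG : 2 < G.card) {x : ℝ} (hx : ∀ i ∈ G, x ∈ Icc (a i) (b i)) :
    ∃ k ∈ G, Icc (a k) (b k) ⊆ ⋃ i ∈ G.erase k, Icc (a i) (b i) := by
  have hne : G.Nonempty := Finset.card_pos.1 (by omega)
  obtain ⟨l, hl, hmin⟩ := G.exists_min_image a hne
  obtain ⟨r, hr, hmax⟩ := G.exists_max_image b hne
  obtain ⟨k, hk, hkn⟩ : ∃ k ∈ G, k ∉ ({l, r} : Finset ι) :=
    Finset.exists_mem_notMem_of_card_lt_card (Finset.card_le_two.trans_lt hG)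
  simp only [Finset.mem_insert, Finset.mem_singleton, not_or] at hkn
  refine ⟨k, hk, fun z hz => ?_⟩
  rcases le_total z x with h | h
  · exact mem_biUnion (Finset.mem_coe.2 (Finset.mem_erase.2 ⟨Ne.symm hkn.1, hl⟩))
      ⟨(hmin k hk).trans hz.1, h.trans (hx l hl).2⟩
  · exact mem_biUnion (Finset.mem_coe.2 (Finset.mem_erase.2 ⟨Ne.symm hkn.2, hr⟩))
      ⟨(hx r hr).1.trans h, hz.2.trans (hmax k hk)⟩

open Set in
/-- A finite family of closed intervals has a subfamily with the same union in which every point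
lies in at most two intervals. -/
theorem exists_subfamily_Icc_card_filter_le_two {ι : Type*} (a b : ι → ℝ) (F : Finset ι) :
    ∃ G ⊆ F, (⋃ i ∈ G, Icc (a i) (b i)) = ⋃ i ∈ F, Icc (a i) (b i) ∧
      ∀ x, (G.filter fun i => x ∈ Icc (a i) (b i)).card ≤ 2 := by
  classical
  induction F using Finset.strongInduction with
  | H F ih =>
    by_cases h : ∀ x, (F.filter fun i => x ∈ Icc (a i) (b i)).card ≤ 2
    · exact ⟨F, subset_rfl, rfl, h⟩
    push Not at h
    obtain ⟨x, hx⟩ := h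
    obtain ⟨k, hk, hsub⟩ := exists_Icc_subset_biUnion_erase a b hx
      fun i hi => (Finset.mem_filter.1 hi).2
    have hkF := (Finset.mem_filter.1 hk).1
    obtain ⟨G, hGF, hGU, hG⟩ := ih (F.erase k) (Finset.erase_ssubset hkF)
    refine ⟨G, hGF.trans (Finset.erase_subset _ _), hGU.trans ?_, hG⟩
    refine (biUnion_subset_biUnion_left (Finset.erase_subset k F)).antisymm ?_
    refine iUnion₂_subset fun i hi => ?_
    by_cases hik : i = k
    · subst hik
      exact hsub.trans (biUnion_subset_biUnion_left
        (Finset.erase_subset_erase i (Finset.filter_subset _ F)))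
    · exact subset_biUnion_of_mem (u := fun i => Icc (a i) (b i))
        (Finset.mem_coe.2 (Finset.mem_erase.2 ⟨hik, hi⟩))

/-- If every point lies in at most `n` members of a finite family of measurable sets, the sum of
their measures is at most `n` times the measure of their union. -/
theorem sum_measure_le_mul_measure_biUnion {α ι : Type*} [MeasurableSpace α] (μ : Measure α)
    (G : Finset ι) (s : ι → Set α) (hs : ∀ i ∈ G, MeasurableSet (s i)) (n : ℕ)
    [∀ x, DecidablePred fun i => x ∈ s i]
    (hn : ∀ x, (G.filter fun i => x ∈ s i).card ≤ n) :
    ∑ i ∈ G, μ (s i) ≤ n * μ (⋃ i ∈ G, s i) := by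
  have hU : MeasurableSet (⋃ i ∈ G, s i) := G.measurableSet_biUnion hs
  calc ∑ i ∈ G, μ (s i) = ∑ i ∈ G, ∫⁻ x, (s i).indicator 1 x ∂μ :=
        Finset.sum_congr rfl fun i hi => (lintegral_indicator_one (hs i hi)).symm
    _ = ∫⁻ x, ∑ i ∈ G, (s i).indicator 1 x ∂μ :=
        (lintegral_finsetSum' G fun i hi => (measurable_one.indicator (hs i hi)).aemeasurable).symm
    _ ≤ ∫⁻ x, n * (⋃ i ∈ G, s i).indicator 1 x ∂μ := by
        refine lintegral_mono fun x => ?_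
        by_cases hx : x ∈ ⋃ i ∈ G, s i
        · rw [Set.indicator_of_mem hx, Pi.one_apply, mul_one]
          simp only [Set.indicator_apply, Pi.one_apply, Finset.sum_boole]
          exact_mod_cast hn x
        · refine (Finset.sum_eq_zero fun i hi => Set.indicator_of_notMem (fun h => hx ?_) _).trans_le
            zero_le
          exact Set.mem_biUnion hi h
    _ = n * μ (⋃ i ∈ G, s i) := by
        rw [lintegral_const_mul _ (measurable_one.indicator hU), lintegral_indicator_one hU]

open Set in
/-- The covering inequality for finite families. -/
theorem mul_measure_biUnion_Icc_le {ι : Type*} (μ ν : Measure ℝ) (c : ℝ≥0∞) (a b : ι → ℝ)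
    (F : Finset ι) (h : ∀ i ∈ F, c * μ (Icc (a i) (b i)) ≤ ν (Icc (a i) (b i))) :
    c * μ (⋃ i ∈ F, Icc (a i) (b i)) ≤ 2 * ν (⋃ i ∈ F, Icc (a i) (b i)) := by
  classical
  obtain ⟨G, hGF, hGU, hG⟩ := exists_subfamily_Icc_card_filter_le_two a b F
  rw [← hGU]
  calc c * μ (⋃ i ∈ G, Icc (a i) (b i)) ≤ c * ∑ i ∈ G, μ (Icc (a i) (b i)) := by
        gcongr
        exact measure_biUnion_finset_le _ _
    _ = ∑ i ∈ G, c * μ (Icc (a i) (b i)) := Finset.mul_sum _ _ _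
    _ ≤ ∑ i ∈ G, ν (Icc (a i) (b i)) := Finset.sum_le_sum fun i hi => h i (hGF hi)
    _ ≤ 2 * ν (⋃ i ∈ G, Icc (a i) (b i)) := by
        refine mod_cast sum_measure_le_mul_measure_biUnion ν G _ (fun _ _ => measurableSet_Icc) 2
          fun x => ?_
        convert hG x

open Set in
/-- The covering inequality for arbitrary families. -/
theorem mul_volume_iUnion_Icc_le {ι : Type*} (ν : Measure ℝ) (c : ℝ≥0∞) (a b : ι → ℝ)
    (hab : ∀ i, a i < b i) (h : ∀ i, c * volume (Icc (a i) (b i)) ≤ ν (Icc (a i) (b i))) :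
    c * volume (⋃ i, Icc (a i) (b i)) ≤ 2 * ν (⋃ i, Icc (a i) (b i)) := by
  have hV : IsOpen (⋃ i, Ioo (a i) (b i)) := isOpen_iUnion fun i => isOpen_Ioo
  have hle : volume (⋃ i, Icc (a i) (b i)) ≤ volume (⋃ i, Ioo (a i) (b i)) :=
    measure_mono_ae <| ae_le_set.2 <|
      (countable_iUnion_Icc_diff_iUnion_Ioo a b hab).measure_zero volume
  refine (mul_le_mul_right hle c).trans ?_
  rw [hV.measure_eq_iSup_isCompact]
  simp only [ENNReal.mul_iSup]
  refine iSup_le fun K => iSup_le fun hKV => iSup_le fun hK => ?_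
  obtain ⟨F, hF⟩ := hK.elim_finite_subcover _ (fun i => isOpen_Ioo) hKV
  calc c * volume K ≤ c * volume (⋃ i ∈ F, Icc (a i) (b i)) := by
        gcongr
        exact hF.trans (iUnion₂_mono fun i _ => Ioo_subset_Icc_self)
    _ ≤ 2 * ν (⋃ i ∈ F, Icc (a i) (b i)) :=
        mul_measure_biUnion_Icc_le volume ν c a b F fun i _ => h i
    _ ≤ 2 * ν (⋃ i, Icc (a i) (b i)) := by
        gcongr 2 * ν ?_
        exact iUnion₂_subset_iUnion _ _

/-- Covering claim in the proof of Lemma 4.16: let `g : ℝ → ℝ` be measurable with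
`0 ≤ g ≤ 2`, and let `ν(S) = ∫_S g dλ` (as a lower integral of the nonnegative
density `g`). If `{[a i, b i]}` is a (possibly uncountable) family of nondegenerate
closed intervals with `ν(I) ≥ (1/2)·λ(I)` for each interval `I` in the family, then
`ν(⋃ I) ≥ (1/4)·λ(⋃ I)`. -/
theorem statement16 (g : ℝ → ℝ) (hg : Measurable g)
    (hg0 : ∀ t, 0 ≤ g t) (hg2 : ∀ t, g t ≤ 2)
    {ι : Type*} (a b : ι → ℝ) (hab : ∀ i, a i < b i)
    (hν : ∀ i, (1/2 : ℝ≥0∞) * volume (Set.Icc (a i) (b i))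
      ≤ ∫⁻ t in Set.Icc (a i) (b i), ENNReal.ofReal (g t)) :
    (1/4 : ℝ≥0∞) * volume (⋃ i, Set.Icc (a i) (b i))
      ≤ ∫⁻ t in ⋃ i, Set.Icc (a i) (b i), ENNReal.ofReal (g t) := by
  set f : ℝ → ℝ≥0∞ := fun t => ENNReal.ofReal (g t)
  have key := mul_volume_iUnion_Icc_le (volume.withDensity f) (1 / 2) a b hab fun i => by
    rw [withDensity_apply _ measurableSet_Icc]
    exact hν i
  rw [withDensity_apply' f] at key
  have hquarter : (1 / 4 : ℝ≥0∞) = 2⁻¹ * (1 / 2) := by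
    rw [one_div, one_div, ← ENNReal.mul_inv (by simp) (by simp)]
    norm_num
  rw [hquarter, mul_assoc]
  refine (mul_le_mul_right key 2⁻¹).trans_eq ?_
  rw [← mul_assoc, ENNReal.inv_mul_cancel (by simp) (by simp), one_mul]
end

section
/- (Voronoi cell diameter bounds, inequality (5.1)) Let H be a real Hilbert space and let Γ ⊆ H be a compact connected set with diam(Γ) ≥ δ for some δ > 0. Let X ⊆ Γ be such that any two distinct points of X are at distance > δ and Γ ⊆ ⋃_{z ∈ X} B(z, δ). For x ∈ X define the Voronoi cell V(x) = {y ∈ Γ : dist(x, y) ≤ dist(z, y) for all z ∈ X}. Then for every x ∈ X, δ/2 ≤ diam(V(x)) < 2δ. -/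
open Metric

/-- A compact set has a point `p` whose distance to a given point `x` is at least half
the diameter of the set. -/
theorem IsCompact.exists_diam_le_two_mul_dist {α : Type*} [PseudoMetricSpace α] {s : Set α}
    (hs : IsCompact s) (hne : s.Nonempty) (x : α) : ∃ p ∈ s, diam s ≤ 2 * dist x p := by
  obtain ⟨p, hp, hpmax⟩ := hs.exists_isMaxOn hne (f := fun y => dist x y) (by fun_prop)
  refine ⟨p, hp, diam_le_of_forall_dist_le (by positivity) fun a ha b hb => ?_⟩
  have h₁ : dist x a ≤ dist x p := hpmax ha
  have h₂ : dist x b ≤ dist x p := hpmax hb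
  linarith [dist_triangle_left a b x]

/-- Voronoi cell diameter bounds (inequality (5.1)): let `Γ` be a compact connected
set in a real Hilbert space with `diam(Γ) ≥ δ`, and let `X ⊆ Γ` be `δ`-separated
with `Γ ⊆ ⋃_{z ∈ X} B(z, δ)`. Then every Voronoi cell
`V(x) = {y ∈ Γ : dist(x,y) ≤ dist(z,y) for all z ∈ X}` satisfies
`δ/2 ≤ diam(V(x)) < 2δ`. -/
theorem statement17
    {H : Type*} [NormedAddCommGroup H] [InnerProductSpace ℝ H] [CompleteSpace H]
    (Γ : Set H) (hcomp : IsCompact Γ) (hconn : IsConnected Γ)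
    (δ : ℝ) (hδ : 0 < δ) (hdiam : δ ≤ Metric.diam Γ)
    (X : Set H) (hXΓ : X ⊆ Γ)
    (hsep : ∀ x ∈ X, ∀ y ∈ X, x ≠ y → δ < dist x y)
    (hcov : Γ ⊆ ⋃ z ∈ X, Metric.ball z δ) :
    ∀ x ∈ X,
      δ / 2 ≤ Metric.diam {y ∈ Γ | ∀ z ∈ X, dist x y ≤ dist z y} ∧
      Metric.diam {y ∈ Γ | ∀ z ∈ X, dist x y ≤ dist z y} < 2 * δ := by
  intro x hx
  set V : Set H := {y ∈ Γ | ∀ z ∈ X, dist x y ≤ dist z y}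
  have hxV : x ∈ V := ⟨hXΓ hx, fun z _ => by simp⟩
  have hclosed : IsClosed {y : H | ∀ z ∈ X, dist x y ≤ dist z y} := by
    simp only [Set.ofPred_forall]
    exact isClosed_biInter fun z _ => isClosed_le (by fun_prop) (by fun_prop)
  have hVcomp : IsCompact V := hcomp.inter_right hclosed
  have hVball : ∀ y ∈ V, dist x y < δ := by
    intro y hy
    obtain ⟨z, hz, hyz⟩ := Set.mem_iUnion₂.1 (hcov hy.1)
    exact (hy.2 z hz).trans_lt (mem_ball'.1 hyz)
  constructor
  · obtain ⟨p, hp, hle⟩ := hcomp.exists_diam_le_two_mul_dist ⟨x, hXΓ hx⟩ x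
    have hfar : δ / 2 ≤ dist x p := by linarith
    obtain ⟨y, hy, hxy⟩ := hconn.isPreconnected.intermediate_value (hXΓ hx) hp
      (f := fun y => dist x y) (by fun_prop)
      (show δ / 2 ∈ Set.Icc (dist x x) (dist x p) from ⟨by rw [dist_self]; positivity, hfar⟩)
    simp only at hxy
    have hyV : y ∈ V := by
      refine ⟨hy, fun z hz => ?_⟩
      rcases eq_or_ne x z with rfl | hne
      · exact le_rfl
      · linarith [hsep x hx z hz hne, dist_triangle_right x z y]
    exact hxy ▸ dist_le_diam_of_mem hVcomp.isBounded hxV hyV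
  · obtain ⟨p, hp, hle⟩ := hVcomp.exists_diam_le_two_mul_dist ⟨x, hxV⟩ x
    linarith [hVball p hp]
end
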